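/- Let H ⊂ ℂ^N be a Levi-flat local real-hypervariety. Then the set S ⊂ H of Segre-degenerate singularities of H is contained in a complex subvariety of complex dimension N−2 or less. -/

import Mathlib

/- Common definitions: real-analytic and complex-analytic subvarieties of ℂ^N,
Levi-flat hypervarieties, CR submanifolds, Segre varieties, etc. -/

open Complex Set Topology Filter
open scoped ENNReal

noncomputable section

abbrev CN (N : ℕ) := Fin N → ℂ

/-- `X` is a (relatively closed) real-analytic subvariety of the open set `U ⊆ ℂ^N`. -/
def IsRealSubvariety (N : ℕ) (U X : Set (CN N)) : Prop :=
  X ⊆ U ∧ closure X ∩ U ⊆ X ∧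
    ∀ p ∈ U, ∃ V : Set (CN N), IsOpen V ∧ p ∈ V ∧ V ⊆ U ∧
      ∃ (k : ℕ) (f : Fin k → CN N → ℝ),
        (∀ i, AnalyticOn ℝ (f i) V) ∧ X ∩ V = {z ∈ V | ∀ i, f i z = 0}

/-- `X` is a (relatively closed) complex-analytic subvariety of the open set `U ⊆ ℂ^N`. -/
def IsComplexSubvariety (N : ℕ) (U X : Set (CN N)) : Prop :=
  X ⊆ U ∧ closure X ∩ U ⊆ X ∧
    ∀ p ∈ U, ∃ V : Set (CN N), IsOpen V ∧ p ∈ V ∧ V ⊆ U ∧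
      ∃ (k : ℕ) (f : Fin k → CN N → ℂ),
        (∀ i, AnalyticOn ℂ (f i) V) ∧ X ∩ V = {z ∈ V | ∀ i, f i z = 0}

/-- `X` is a real-analytic subvariety of the (not necessarily open) set `V`. -/
def IsRealSubvarietyIn (N : ℕ) (V X : Set (CN N)) : Prop :=
  X ⊆ V ∧ closure X ∩ V ⊆ X ∧
    ∀ p ∈ V, ∃ W : Set (CN N), IsOpen W ∧ p ∈ W ∧
      ∃ (k : ℕ) (f : Fin k → CN N → ℝ),
        (∀ i, AnalyticOn ℝ (f i) W) ∧ X ∩ W = {z ∈ V ∩ W | ∀ i, f i z = 0}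

/-- `X` is a complex-analytic subvariety of the (not necessarily open) set `V`. -/
def IsComplexSubvarietyIn (N : ℕ) (V X : Set (CN N)) : Prop :=
  X ⊆ V ∧ closure X ∩ V ⊆ X ∧
    ∀ p ∈ V, ∃ W : Set (CN N), IsOpen W ∧ p ∈ W ∧
      ∃ (k : ℕ) (f : Fin k → CN N → ℂ),
        (∀ i, AnalyticOn ℂ (f i) W) ∧ X ∩ W = {z ∈ V ∩ W | ∀ i, f i z = 0}

/-- Near `p`, `X` is a real-analytic submanifold of ℂ^N of real dimension `d`,
cut out by `2N - d` real-analytic functions with linearly independent differentials. -/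
def IsSubmanifoldAtDim (N d : ℕ) (X : Set (CN N)) (p : CN N) : Prop :=
  ∃ (V : Set (CN N)) (f : Fin (2 * N - d) → CN N → ℝ),
    IsOpen V ∧ p ∈ V ∧ (∀ i, AnalyticOn ℝ (f i) V) ∧
    (∀ z ∈ V, LinearIndependent ℝ fun i => fderiv ℝ (f i) z) ∧
    X ∩ V = {z ∈ V | ∀ i, f i z = 0}

/-- Near `p`, `X` is a complex submanifold of ℂ^N of complex dimension `d`. -/
def IsCxSubmanifoldAtDim (N d : ℕ) (X : Set (CN N)) (p : CN N) : Prop :=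
  ∃ (V : Set (CN N)) (f : Fin (N - d) → CN N → ℂ),
    IsOpen V ∧ p ∈ V ∧ (∀ i, AnalyticOn ℂ (f i) V) ∧
    (∀ z ∈ V, LinearIndependent ℂ fun i => fderiv ℂ (f i) z) ∧
    X ∩ V = {z ∈ V | ∀ i, f i z = 0}

/-- Points near which `X` is a real-analytic submanifold of some dimension. -/
def regPts (N : ℕ) (X : Set (CN N)) : Set (CN N) :=
  {p ∈ X | ∃ d, IsSubmanifoldAtDim N d X p}

/-- The singular set `X_s` of a real-analytic subvariety. -/
def singSet (N : ℕ) (X : Set (CN N)) : Set (CN N) := X \ regPts N X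

/-- `H*`: the points near which `H` is a nonsingular real-analytic hypersurface. -/
def hypStar (N : ℕ) (H : Set (CN N)) : Set (CN N) :=
  {p ∈ H | IsSubmanifoldAtDim N (2 * N - 1) H p}

/-- Near `p` the hypersurface `H` is given by `Im f = 0` for a holomorphic `f` with
nonvanishing differential (the local model of a nonsingular Levi-flat hypersurface). -/
def IsLeviFlatHypAt (N : ℕ) (H : Set (CN N)) (p : CN N) : Prop :=
  ∃ (V : Set (CN N)) (f : CN N → ℂ),
    IsOpen V ∧ p ∈ V ∧ AnalyticOn ℂ f V ∧ (∀ z ∈ V, fderiv ℂ f z ≠ 0) ∧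
    H ∩ V = {z ∈ V | (f z).im = 0}

/-- A Levi-flat real-hypervariety `H` of the open set `U`: a relatively closed
real-analytic subvariety of real dimension `2N - 1` whose regular hypersurface
part `H*` is Levi-flat. -/
def IsLeviFlatHypervariety (N : ℕ) (U H : Set (CN N)) : Prop :=
  IsOpen U ∧ IsRealSubvariety N U H ∧ dimH H = ((2 * N - 1 : ℕ) : ℝ≥0∞) ∧
    ∀ p ∈ hypStar N H, IsLeviFlatHypAt N H p

/-- Near `p`, in suitable local holomorphic coordinates `Φ`, the set `M` is given by
`Im z₁ = ⋯ = Im z_j = 0`, `z_{j+1} = ⋯ = z_k = 0`: `M` is a Levi-flat CR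
submanifold at `p`. -/
def IsLeviFlatCRAt (N : ℕ) (M : Set (CN N)) (p : CN N) : Prop :=
  ∃ (V : Set (CN N)) (Φ : CN N → CN N) (j k : ℕ),
    j ≤ k ∧ k ≤ N ∧ IsOpen V ∧ p ∈ V ∧
    AnalyticOn ℂ Φ V ∧ InjOn Φ V ∧
    (∀ z ∈ V, Function.Bijective ⇑(fderiv ℂ Φ z)) ∧
    M ∩ V = {z ∈ V | (∀ i : Fin N, (i : ℕ) < j → (Φ z i).im = 0) ∧
      ∀ i : Fin N, j ≤ (i : ℕ) → (i : ℕ) < k → Φ z i = 0}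

/-- The holomorphic part `∂r` of the differential of a real function `r` at `z`,
as a complex-valued form: `∂r(v) = dr(v) - i · dr(i·v)` (up to a factor `2`). -/
def delForm (N : ℕ) (r : CN N → ℝ) (z : CN N) : CN N → ℂ := fun v =>
  Complex.ofReal (fderiv ℝ r z v) -
    Complex.I * Complex.ofReal (fderiv ℝ r z (Complex.I • v))

/-- `M` is a generic submanifold near `p`: locally cut out by real-analytic
`r₁, …, r_k` with `∂r₁, …, ∂r_k` linearly independent. -/
def IsGenericSubmanifoldAt (N : ℕ) (M : Set (CN N)) (p : CN N) : Prop :=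
  ∃ (V : Set (CN N)) (k : ℕ) (r : Fin k → CN N → ℝ),
    IsOpen V ∧ p ∈ V ∧ (∀ i, AnalyticOn ℝ (r i) V) ∧
    (∀ z ∈ V, LinearIndependent ℝ fun i => fderiv ℝ (r i) z) ∧
    (∀ z ∈ V, LinearIndependent ℂ fun i => delForm N (r i) z) ∧
    M ∩ V = {z ∈ V | ∀ i, r i z = 0}

/-- Near `p`, in suitable local holomorphic coordinates, `M` is `{Im z₁ = Im z₂ = 0}`:
the local model of a generic Levi-flat submanifold of real dimension `2N - 2`. -/
def IsGenericLeviFlat2At (N : ℕ) (M : Set (CN N)) (p : CN N) : Prop :=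
  ∃ (V : Set (CN N)) (Φ : CN N → CN N),
    IsOpen V ∧ p ∈ V ∧ AnalyticOn ℂ Φ V ∧ InjOn Φ V ∧
    (∀ z ∈ V, Function.Bijective ⇑(fderiv ℂ Φ z)) ∧
    M ∩ V = {z ∈ V | ∀ i : Fin N, (i : ℕ) < 2 → (Φ z i).im = 0}

/-- The complex-tangent (CR) vectors to `M` at `p`. -/
def crTangent (N : ℕ) (M : Set (CN N)) (p : CN N) : Set (CN N) :=
  {v | v ∈ tangentConeAt ℝ M p ∧ Complex.I • v ∈ tangentConeAt ℝ M p}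

/-- The CR dimension of `M` at `p`. -/
def crDim (N : ℕ) (M : Set (CN N)) (p : CN N) : ℕ :=
  Module.finrank ℂ (Submodule.span ℂ (crTangent N M p))

/-- `M` is a real-analytic CR submanifold: a real-analytic submanifold with
constant CR dimension. -/
def IsCRSubmanifold (N : ℕ) (M : Set (CN N)) : Prop :=
  (∃ d, ∀ p ∈ M, IsSubmanifoldAtDim N d M p) ∧ ∃ m, ∀ p ∈ M, crDim N M p = m

/-- Coordinatewise complex conjugation. -/
def conjPt (N : ℕ) (z : CN N) : CN N := fun i => starRingEnd ℂ (z i)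

/-- `R` is the complexification `r(z, w̄)` of the real-analytic function `r` on `U`:
it is holomorphic on `U × *U` (where `*U` is the conjugate of `U`) and `R(z, z̄) = r(z)`. -/
def IsComplexification (N : ℕ) (U : Set (CN N)) (r : CN N → ℝ)
    (R : CN N → CN N → ℂ) : Prop :=
  AnalyticOn ℂ (fun zw : CN N × CN N => R zw.1 zw.2) (U ×ˢ (conjPt N '' U)) ∧
    ∀ z ∈ U, R z (conjPt N z) = Complex.ofReal (r z)

/-- The Segre variety `Σ_p(U, r) = {z ∈ U : r(z, p̄) = 0}`, for `R` the
complexification of `r`. -/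
def segreSet (N : ℕ) (U : Set (CN N)) (R : CN N → CN N → ℂ) (p : CN N) : Set (CN N) :=
  {z ∈ U | R z (conjPt N p) = 0}

/-- `p` is a Segre-degenerate singularity of `H`: for every local defining function `r` of
`H` at `p`, the function `z ↦ r(z, p̄)` vanishes identically near `p`. -/
def IsSegreDegenerateAt (N : ℕ) (H : Set (CN N)) (p : CN N) : Prop :=
  ∀ (V : Set (CN N)) (r : CN N → ℝ) (R : CN N → CN N → ℂ),
    IsOpen V → p ∈ V → AnalyticOn ℝ r V → IsComplexification N V r R →
    H ∩ V = {z ∈ V | r z = 0} → ∀ᶠ z in nhds p, R z (conjPt N p) = 0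

/-- `Σ'`: the union of all complex subvarieties of `V` of complex dimension `N - 1`
contained in `H`. -/
def sigmaPrime (N : ℕ) (H V : Set (CN N)) : Set (CN N) :=
  ⋃₀ {W | IsComplexSubvariety N V W ∧ W ⊆ H ∧ dimH W = ((2 * N - 2 : ℕ) : ℝ≥0∞)}

/-- `p` is a leaf-degenerate point of `H`: the germ `Σ'_p(H)` is not a complex variety of
dimension `N - 1`, i.e. there is no single complex subvariety `W ∋ p` of dimension `N - 1`
inside `H` containing all complex hypervarieties of `H` near `p`. -/
def IsLeafDegenerateAt (N : ℕ) (H : Set (CN N)) (p : CN N) : Prop :=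
  ¬∃ (V W : Set (CN N)), IsOpen V ∧ p ∈ V ∧ p ∈ W ∧ W ⊆ H ∧
    IsComplexSubvariety N V W ∧ dimH W = ((2 * N - 2 : ℕ) : ℝ≥0∞) ∧
    ∀ V' : Set (CN N), IsOpen V' → V' ⊆ V → sigmaPrime N H V' ⊆ W

/-- An irreducible complex subvariety of `U`. -/
def IsIrreducibleCxSubvariety (N : ℕ) (U W : Set (CN N)) : Prop :=
  IsComplexSubvariety N U W ∧ W.Nonempty ∧
    ∀ W₁ W₂ : Set (CN N), IsComplexSubvariety N U W₁ → IsComplexSubvariety N U W₂ →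
      W = W₁ ∪ W₂ → W = W₁ ∨ W = W₂

/-- The germ of the real-analytic variety `H` at `p` is irreducible: in any decomposition
of `H` near `p` into two real-analytic subvarieties, one of them contains `H` near `p`. -/
def IsIrreducibleGermAt (N : ℕ) (H : Set (CN N)) (p : CN N) : Prop :=
  ∀ V H₁ H₂ : Set (CN N), IsOpen V → p ∈ V →
    IsRealSubvariety N V H₁ → IsRealSubvariety N V H₂ → H ∩ V = H₁ ∪ H₂ →
    ∃ V' : Set (CN N), IsOpen V' ∧ p ∈ V' ∧ (H ∩ V' ⊆ H₁ ∨ H ∩ V' ⊆ H₂)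

/-- `M` is minimal at `p`: every (real-analytic) CR submanifold of `M` through `p` with
the same CR dimension contains a neighborhood of `p` in `M`. -/
def IsMinimalAt (N : ℕ) (M : Set (CN N)) (p : CN N) : Prop :=
  ∀ M' : Set (CN N), p ∈ M' → M' ⊆ M →
    (∃ d, ∀ q ∈ M', IsSubmanifoldAtDim N d M' q) →
    (∀ q ∈ M', crDim N M' q = crDim N M p) →
    ∃ V : Set (CN N), IsOpen V ∧ p ∈ V ∧ M ∩ V ⊆ M'

/-- `O` is (a representative of) the local CR orbit of `M` at `p`, of dimension `d`:
the smallest CR submanifold of `M` through `p` of the same CR dimension as `M` at `p`. -/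
def IsCROrbitAt (N d : ℕ) (M O : Set (CN N)) (p : CN N) : Prop :=
  p ∈ O ∧ O ⊆ M ∧ (∀ q ∈ O, IsSubmanifoldAtDim N d O q) ∧
    (∀ q ∈ O, crDim N O q = crDim N M p) ∧
    ∀ O' : Set (CN N), p ∈ O' → O' ⊆ M →
      (∃ d', ∀ q ∈ O', IsSubmanifoldAtDim N d' O' q) →
      (∀ q ∈ O', crDim N O' q = crDim N M p) →
      ∃ V : Set (CN N), IsOpen V ∧ p ∈ V ∧ O ∩ V ⊆ O'

/-- `r` generates the ideal of germs at `p` of real-analytic functions vanishing on `H`. -/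
def GeneratesVanishingIdealAt (N : ℕ) (H V : Set (CN N)) (r : CN N → ℝ) (p : CN N) :
    Prop :=
  (∀ z ∈ H ∩ V, r z = 0) ∧
    ∀ (V' : Set (CN N)) (g : CN N → ℝ), IsOpen V' → p ∈ V' → AnalyticOn ℝ g V' →
      (∀ z ∈ H ∩ V', g z = 0) →
      ∃ (V'' : Set (CN N)) (q : CN N → ℝ), IsOpen V'' ∧ p ∈ V'' ∧ V'' ⊆ V ∩ V' ∧
        AnalyticOn ℝ q V'' ∧ ∀ z ∈ V'', g z = q z * r z

/-- The exterior derivative of a one-form `ω`, evaluated at `z` on `(u, v)`. -/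
def oneFormD (N : ℕ) (ω : CN N → (CN N →L[ℂ] ℂ)) (z u v : CN N) : ℂ :=
  fderiv ℂ ω z u v - fderiv ℂ ω z v u

/-- `(ω ∧ dω)(u, v, w)` at `z`; its vanishing is complete integrability of `ω`. -/
def integrabilityWedge (N : ℕ) (ω : CN N → (CN N →L[ℂ] ℂ)) (z u v w : CN N) : ℂ :=
  ω z u * oneFormD N ω z v w - ω z v * oneFormD N ω z u w + ω z w * oneFormD N ω z u v

/-- Gateaux holomorphy: differentiability along complex lines. -/
def GateauxOn {E F : Type*} [NormedAddCommGroup E] [NormedSpace ℂ E]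
    [NormedAddCommGroup F] [NormedSpace ℂ F] (f : E → F) (U : Set E) : Prop :=
  ∀ x ∈ U, ∀ v : E, DifferentiableAt ℂ (fun t : ℂ => f (x + t • v)) 0

theorem DifferentiableOn.gateauxOn {E F : Type*} [NormedAddCommGroup E] [NormedSpace ℂ E]
    [NormedAddCommGroup F] [NormedSpace ℂ F] {f : E → F} {U : Set E}
    (hU : IsOpen U) (hf : DifferentiableOn ℂ f U) : GateauxOn f U := by
  intro x hx v
  have h : DifferentiableAt ℂ f (x + (0 : ℂ) • v) := by
    simpa using hf.differentiableAt (hU.mem_nhds hx)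
  exact h.comp (0 : ℂ) (f := fun t : ℂ => x + t • v) (by fun_prop)

/-- `x ↦ f x ·` as a map into continuous functions on a compact space is Gateaux holomorphic. -/
theorem gateauxOn_curry {E F K : Type*} [NormedAddCommGroup E] [NormedSpace ℂ E]
    [NormedAddCommGroup F] [NormedSpace ℂ F] [CompleteSpace F] [TopologicalSpace K]
    [CompactSpace K] {Φ : E → C(K, F)} {U : Set E} (hU : IsOpen U) (hΦ : ContinuousOn Φ U)
    (hd : ∀ s, GateauxOn (fun x => Φ x s) U) : GateauxOn Φ U := by
  intro x hx v
  have hcont : Continuous fun t : ℂ => x + t • v := by fun_prop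
  have hmem : (fun t : ℂ => x + t • v) ⁻¹' U ∈ 𝓝 (0 : ℂ) :=
    (hU.preimage hcont).mem_nhds (by simpa using hx)
  obtain ⟨ε, hε, hball⟩ := Metric.nhds_basis_closedBall.mem_iff.1 hmem
  have hcb : ContinuousOn (fun t : ℂ => Φ (x + t • v)) (Metric.closedBall 0 ε) :=
    hΦ.comp hcont.continuousOn hball
  lift ε to NNReal using hε.le
  have hε' : 0 < ε := by exact_mod_cast hε
  have hci : CircleIntegrable (fun t : ℂ => Φ (x + t • v)) 0 ε :=
    (hcb.mono Metric.sphere_subset_closedBall).circleIntegrable ε.2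
  have hps := (hasFPowerSeriesOn_cauchy_integral hci hε').analyticAt.differentiableAt
  refine hps.congr_of_eventuallyEq ?_
  filter_upwards [Metric.ball_mem_nhds (0 : ℂ) hε] with t ht
  ext s
  have hdiff : DiffContOnCl ℂ (fun t : ℂ => Φ (x + t • v) s) (Metric.ball 0 ε) := by
    refine ⟨fun u hu => ?_, ?_⟩
    · have := hd s (x + u • v) (hball (Metric.ball_subset_closedBall hu)) v
      have h2 : (fun t : ℂ => Φ (x + t • v) s)
          = (fun t : ℂ => Φ (x + u • v + t • v) s) ∘ (fun t => t - u) := by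
        ext t; simp only [Function.comp]; congr 2; module
      rw [h2]
      refine DifferentiableAt.differentiableWithinAt ?_
      refine DifferentiableAt.comp u ?_ (by fun_prop)
      simpa using this
    · refine ContinuousOn.mono ?_ Metric.closure_ball_subset_closedBall
      exact (ContinuousMap.evalCLM ℂ (M := F) s).continuous.comp_continuousOn hcb
  have h1 := hdiff.circleIntegral_sub_inv_smul ht
  have hci2 : CircleIntegrable (fun z : ℂ => (z - t)⁻¹ • Φ (x + z • v)) 0 ε := by
    refine ContinuousOn.circleIntegrable ε.2 (ContinuousOn.fun_smul
      (f := fun z : ℂ => (z - t)⁻¹) (g := fun z : ℂ => Φ (x + z • v)) ?_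
      (hcb.mono Metric.sphere_subset_closedBall))
    refine ContinuousOn.inv₀ (by fun_prop) fun z hz hzt => ?_
    rw [sub_eq_zero] at hzt
    subst hzt
    simp only [mem_sphere_iff_norm, Metric.mem_ball, dist_zero_right, sub_zero] at hz ht
    linarith
  have h2 : (∮ z in C(0, ε), (z - t)⁻¹ • Φ (x + z • v)) s
      = ∮ z in C(0, ε), (z - t)⁻¹ • Φ (x + z • v) s := by
    have := (ContinuousMap.evalCLM ℂ (M := F) s).intervalIntegral_comp_comm hci2.out
    simp only [ContinuousMap.evalCLM_apply] at this
    simpa [circleIntegral] using this.symm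
  simp only [ContinuousMap.smul_apply, h2, h1]
  rw [smul_smul, inv_mul_cancel₀ (by simp [Real.pi_ne_zero]), one_smul]

/-- Osgood's lemma for the space `E` and values in Banach spaces. -/
def Osgood (E : Type*) [NormedAddCommGroup E] [NormedSpace ℂ E] : Prop :=
  ∀ (F : Type) [NormedAddCommGroup F] [NormedSpace ℂ F] [CompleteSpace F] (f : E → F) (U : Set E),
    IsOpen U → ContinuousOn f U → GateauxOn f U → AnalyticOnNhd ℂ f U

theorem osgood_complex : Osgood ℂ := by
  intro F _ _ _ f U hU _ hg
  refine DifferentiableOn.analyticOnNhd (fun x hx => ?_) hU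
  have h := hg x hx 1
  have h2 : f = (fun t : ℂ => f (x + t • (1 : ℂ))) ∘ (fun t => t - x) := by
    ext t; simp
  rw [h2]
  refine (DifferentiableAt.comp x ?_ (by fun_prop)).differentiableWithinAt
  simpa using h

theorem Osgood.of_equiv {E E' : Type*} [NormedAddCommGroup E] [NormedSpace ℂ E]
    [NormedAddCommGroup E'] [NormedSpace ℂ E'] (e : E ≃L[ℂ] E') (h : Osgood E') : Osgood E := by
  intro F _ _ _ f U hU hc hg
  have h1 := h F (f ∘ e.symm) (e.symm ⁻¹' U) (hU.preimage e.symm.continuous)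
    (hc.comp e.symm.continuous.continuousOn fun _ hx => hx) (fun x hx v => by
      simpa using hg (e.symm x) hx (e.symm v))
  intro x hx
  have h2 : f = (f ∘ e.symm) ∘ e := by ext; simp
  rw [h2]
  exact (h1 (e x) (by simpa using hx)).comp (e.analyticAt x)

/-- The circle parametrization on a compact interval. -/
abbrev circleIcc : Type := Set.Icc (0 : ℝ) (2 * Real.pi)

/-- Lebesgue measure on the parameter interval of the circle. -/
def circleIccMeasure : MeasureTheory.Measure circleIcc :=
  MeasureTheory.Measure.comap Subtype.val MeasureTheory.volume

instance : MeasureTheory.IsFiniteMeasure circleIccMeasure :=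
  ⟨by
    rw [circleIccMeasure, (MeasurableEmbedding.subtype_coe measurableSet_Icc).comap_apply,
      image_univ, Subtype.range_coe]
    exact measure_Icc_lt_top⟩

theorem circleIntegral_eq_icc {F : Type*} [NormedAddCommGroup F] [NormedSpace ℂ F]
    (f : ℂ → F) (c : ℂ) (r : ℝ) : (∮ z in C(c, r), f z) =
      ∫ θ : circleIcc, deriv (circleMap c r) θ • f (circleMap c r θ) ∂circleIccMeasure := by
  rw [circleIntegral, intervalIntegral.integral_of_le Real.two_pi_pos.le,
    ← MeasureTheory.integral_Icc_eq_integral_Ioc,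
    circleIccMeasure, ← MeasureTheory.integral_subtype_comap measurableSet_Icc]

/-- Integration as a continuous linear functional on continuous functions. -/
def icmIntegral (F : Type*) [NormedAddCommGroup F] [NormedSpace ℂ F] [CompleteSpace F] :
    C(circleIcc, F) →L[ℂ] F :=
  LinearMap.mkContinuous
    { toFun := fun φ => ∫ θ : circleIcc, φ θ ∂circleIccMeasure
      map_add' := fun φ ψ => MeasureTheory.integral_add
        (φ.continuous.integrable_of_hasCompactSupport (HasCompactSupport.of_compactSpace _))
        (ψ.continuous.integrable_of_hasCompactSupport (HasCompactSupport.of_compactSpace _))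
      map_smul' := fun c _ => MeasureTheory.integral_smul c _ }
    (circleIccMeasure.real univ) (fun φ =>
      (MeasureTheory.norm_integral_le_of_norm_le_const
        (Eventually.of_forall fun θ => φ.norm_coe_le_norm θ)).trans_eq (mul_comm _ _))

theorem icmIntegral_apply {F : Type*} [NormedAddCommGroup F] [NormedSpace ℂ F] [CompleteSpace F]
    (φ : C(circleIcc, F)) : icmIntegral F φ = ∫ θ : circleIcc, φ θ ∂circleIccMeasure := rfl

/-- Pointwise multiplication as a continuous bilinear map. -/
def icmSmul (F : Type*) [NormedAddCommGroup F] [NormedSpace ℂ F] :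
    C(circleIcc, ℂ) →L[ℂ] C(circleIcc, F) →L[ℂ] C(circleIcc, F) :=
  LinearMap.mkContinuous₂
    (LinearMap.mk₂ ℂ (fun k φ => ⟨fun θ => k θ • φ θ, by fun_prop⟩)
      (fun _ _ _ => by ext; simp [add_smul]) (fun _ _ _ => by ext; simp [mul_smul])
      (fun _ _ _ => by ext; simp) (fun c k φ => by ext; simp [smul_comm c]))
    1 (fun k φ => by
      refine (ContinuousMap.norm_le _ (by positivity)).2 fun θ => ?_
      simp only [LinearMap.mk₂_apply, ContinuousMap.coe_mk, norm_smul, one_mul]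
      gcongr
      · exact k.norm_coe_le_norm θ
      · exact φ.norm_coe_le_norm θ)

theorem icmSmul_apply {F : Type*} [NormedAddCommGroup F] [NormedSpace ℂ F]
    (k : C(circleIcc, ℂ)) (φ : C(circleIcc, F)) (θ : circleIcc) :
    icmSmul F k φ θ = k θ • φ θ := rfl

/-- Under Osgood's lemma on `E`, the restriction `x ↦ f (x, ·)` to a circle is analytic as a
Banach-valued map. -/
theorem Osgood.exists_curry {E : Type*} {F : Type} [NormedAddCommGroup E] [NormedSpace ℂ E]
    [NormedAddCommGroup F] [NormedSpace ℂ F] [CompleteSpace F] (hE : Osgood E)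
    {f : E × ℂ → F} {U : Set E} {c : ℂ} {r : ℝ} (hr : 0 ≤ r) (hU : IsOpen U)
    (hf : ContinuousOn f (U ×ˢ Metric.sphere c r))
    (hd : ∀ s ∈ Metric.sphere c r, GateauxOn (fun x => f (x, s)) U) :
    ∃ Φ : E → C(circleIcc, F), AnalyticOnNhd ℂ Φ U ∧
      ∀ x ∈ U, ∀ θ : circleIcc, Φ x θ = f (x, circleMap c r θ) := by
  classical
  let Ψ : U → C(circleIcc, F) := ContinuousMap.curry
    ⟨fun p : U × circleIcc => f (p.1, circleMap c r p.2),
      hf.comp_continuous (by fun_prop) fun p => ⟨p.1.2, circleMap_mem_sphere c hr _⟩⟩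
  have hΨ : Continuous Ψ := ContinuousMap.continuous _
  let Φ : E → C(circleIcc, F) := fun x => if h : x ∈ U then Ψ ⟨x, h⟩ else 0
  have hΦ : ∀ x ∈ U, ∀ θ : circleIcc, Φ x θ = f (x, circleMap c r θ) := by
    intro x hx θ
    simp only [Φ, hx, dif_pos]
    rfl
  have hΦc : ContinuousOn Φ U := by
    rw [continuousOn_iff_continuous_domRestrict]
    convert hΨ using 1
    ext x θ
    simp [Φ, Set.domRestrict]
  refine ⟨Φ, hE _ Φ U hU hΦc (gateauxOn_curry hU hΦc fun θ x hx v => ?_), hΦ⟩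
  refine (hd _ (circleMap_mem_sphere c hr θ) x hx v).congr_of_eventuallyEq ?_
  have hcont : Continuous fun t : ℂ => x + t • v := by fun_prop
  have hmem : (fun t : ℂ => x + t • v) ⁻¹' U ∈ 𝓝 (0 : ℂ) :=
    (hU.preimage hcont).mem_nhds (by simpa using hx)
  filter_upwards [hmem] with t ht
  exact hΦ _ ht θ

/-- The curve `θ ↦ deriv (circleMap c r) θ` as a continuous function. -/
def circleDeriv (c : ℂ) (r : ℝ) : C(circleIcc, ℂ) :=
  ⟨fun θ => deriv (circleMap c r) θ, by simp only [deriv_circleMap]; fun_prop⟩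

theorem Osgood.prod {E : Type*} [NormedAddCommGroup E] [NormedSpace ℂ E] (hE : Osgood E) :
    Osgood (E × ℂ) := by
  intro F _ _ _ f U hU hc hg x hx
  obtain ⟨x0, t0⟩ := x
  obtain ⟨ρ, hρ, hsub⟩ := Metric.nhds_basis_closedBall.mem_iff.1 (hU.mem_nhds hx)
  rw [← closedBall_prod_same] at hsub
  have hsp : Metric.ball x0 ρ ×ˢ Metric.sphere t0 ρ ⊆ U := fun p hp =>
    hsub ⟨Metric.ball_subset_closedBall hp.1, Metric.sphere_subset_closedBall hp.2⟩
  obtain ⟨Φ, hΦa, hΦ⟩ := hE.exists_curry hρ.le Metric.isOpen_ball (hc.mono hsp)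
    (fun s hs y hy v => by simpa using hg (y, s) (hsp ⟨hy, hs⟩) (v, 0))
  have hne : ∀ t ∈ Metric.ball t0 ρ, ∀ s ∈ Metric.sphere t0 ρ, s - t ≠ 0 := by
    intro t ht s hs h
    rw [sub_eq_zero] at h
    subst h
    rw [mem_sphere_iff_norm] at hs
    rw [mem_ball_iff_norm] at ht
    linarith
  obtain ⟨k, hka, hk⟩ := osgood_complex.exists_curry (F := ℂ)
    (f := fun p : ℂ × ℂ => (p.2 - p.1)⁻¹) (c := t0) hρ.le
    (Metric.isOpen_ball (x := t0) (ε := ρ))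
    (ContinuousOn.inv₀ (by fun_prop) fun p hp => hne p.1 hp.1 p.2 hp.2)
    (fun s hs => DifferentiableOn.gateauxOn Metric.isOpen_ball
      (DifferentiableOn.inv (by fun_prop) fun t ht => hne t ht s hs))
  let Q : E × ℂ → F := fun p => (2 * Real.pi * I : ℂ)⁻¹ •
    icmIntegral F (icmSmul F (circleDeriv t0 ρ) (icmSmul F (k p.2) (Φ p.1)))
  have hQ : AnalyticAt ℂ Q (x0, t0) := by
    have h1 : AnalyticAt ℂ (fun p : E × ℂ => (k p.2, Φ p.1)) (x0, t0) :=
      ((hka t0 (Metric.mem_ball_self hρ)).comp_of_eq analyticAt_snd rfl).prod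
        ((hΦa x0 (Metric.mem_ball_self hρ)).comp_of_eq analyticAt_fst rfl)
    have h2 := ((icmSmul F).analyticAt_bilinear (k t0, Φ x0)).comp_of_eq h1 rfl
    exact ((((icmIntegral F).comp (icmSmul F (circleDeriv t0 ρ))).analyticAt _).comp h2).const_smul
  refine hQ.congr ?_
  have hopen : Metric.ball x0 ρ ×ˢ Metric.ball t0 ρ ∈ 𝓝 (x0, t0) :=
    prod_mem_nhds (Metric.ball_mem_nhds _ hρ) (Metric.ball_mem_nhds _ hρ)
  filter_upwards [hopen] with p hp
  obtain ⟨y, t⟩ := p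
  have hdiff : DiffContOnCl ℂ (fun s : ℂ => f (y, s)) (Metric.ball t0 ρ) := by
    refine ⟨fun u hu => ?_, ?_⟩
    · have := hg (y, u) (hsub ⟨Metric.ball_subset_closedBall hp.1,
        Metric.ball_subset_closedBall hu⟩) (0, 1)
      have h2 : (fun s : ℂ => f (y, s))
          = (fun s : ℂ => f ((y, u) + s • (0, 1))) ∘ (fun s => s - u) := by
        ext s; simp
      rw [h2]
      refine (DifferentiableAt.comp u ?_ (by fun_prop)).differentiableWithinAt
      simpa using this
    · refine hc.comp (by fun_prop) fun s hs => hsub ⟨Metric.ball_subset_closedBall hp.1,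
        Metric.closure_ball_subset_closedBall hs⟩
  have h1 := hdiff.circleIntegral_sub_inv_smul hp.2
  have h2 : Q (y, t) = (2 * Real.pi * I : ℂ)⁻¹ • ∮ s in C(t0, ρ), (s - t)⁻¹ • f (y, s) := by
    simp only [Q, icmIntegral_apply, circleIntegral_eq_icc]
    congr 2
    funext θ
    simp only [icmSmul_apply, hΦ y hp.1, hk t hp.2]
    rfl
  rw [h2, h1, smul_smul, inv_mul_cancel₀ (by simp [Real.pi_ne_zero]), one_smul]

theorem osgood (E : Type*) [NormedAddCommGroup E] [NormedSpace ℂ E] [FiniteDimensional ℂ E] :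
    Osgood E := by
  suffices h : ∀ n : ℕ, Osgood (Fin n → ℂ) from
    (h (Module.finrank ℂ E)).of_equiv (ContinuousLinearEquiv.ofFinrankEq (by simp))
  intro n
  induction n with
  | zero =>
    intro F _ _ _ f U _ _ _ x _
    have : f = fun _ => f x := funext fun y => by rw [Subsingleton.elim y x]
    rw [this]
    exact analyticAt_const
  | succ n ih => exact ih.prod.of_equiv (ContinuousLinearEquiv.ofFinrankEq (by simp))

theorem analyticOnNhd_of_differentiableOn {E : Type*} {F : Type} [NormedAddCommGroup E]
    [NormedSpace ℂ E] [FiniteDimensional ℂ E] [NormedAddCommGroup F] [NormedSpace ℂ F]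
    [CompleteSpace F] {f : E → F} {U : Set E} (hU : IsOpen U) (hf : DifferentiableOn ℂ f U) :
    AnalyticOnNhd ℂ f U :=
  osgood E F f U hU hf.continuousOn (hf.gateauxOn hU)

/-- A circle integral depending analytically on a parameter is analytic in the parameter. -/
theorem analyticAt_circleIntegral {E : Type*} {F : Type} [NormedAddCommGroup E]
    [NormedSpace ℂ E] [FiniteDimensional ℂ E] [NormedAddCommGroup F] [NormedSpace ℂ F]
    [CompleteSpace F] {f : E × ℂ → F} {x₀ : E} {c : ℂ} {r : ℝ} (hr : 0 ≤ r)
    (hf : ∀ s ∈ Metric.sphere c r, AnalyticAt ℂ f (x₀, s)) :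
    AnalyticAt ℂ (fun x => ∮ s in C(c, r), f (x, s)) x₀ := by
  have hopen := isOpen_analyticAt ℂ f
  obtain ⟨u, v, hu, hv, hxu, hsv, huv⟩ := generalized_tube_lemma isCompact_singleton
    (isCompact_sphere c r) hopen (s := {x₀}) (fun p hp => by
      obtain ⟨h1, h2⟩ := hp
      have : p = (x₀, p.2) := Prod.ext h1 rfl
      rw [this]
      exact hf _ h2)
  have ha : ∀ x ∈ u, ∀ s ∈ Metric.sphere c r, AnalyticAt ℂ f (x, s) := fun x hx s hs =>
    huv ⟨hx, hsv hs⟩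
  obtain ⟨Φ, hΦa, hΦ⟩ := (osgood E).exists_curry (f := f) hr hu
    (fun p hp => (ha p.1 hp.1 p.2 hp.2).continuousAt.continuousWithinAt)
    (fun s hs => DifferentiableOn.gateauxOn hu fun x hx => by
      refine ((ha x hx s hs).differentiableAt.comp x (f := fun x => (x, s))
        (by fun_prop)).differentiableWithinAt)
  have h1 : AnalyticAt ℂ (fun x => icmIntegral F (icmSmul F (circleDeriv c r) (Φ x))) x₀ :=
    (((icmIntegral F).comp (icmSmul F (circleDeriv c r))).analyticAt _).comp
      (hΦa x₀ (hxu rfl))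
  refine h1.congr ?_
  filter_upwards [hu.mem_nhds (hxu rfl)] with x hx
  rw [circleIntegral_eq_icc, icmIntegral_apply]
  congr 1
  funext θ
  rw [icmSmul_apply, hΦ x hx]
  rfl

section FunProp

variable {X Y Z : Type*} [NormedAddCommGroup X] [NormedSpace ℂ X]
  [NormedAddCommGroup Y] [NormedSpace ℂ Y] [NormedAddCommGroup Z] [NormedSpace ℂ Z]

@[fun_prop]
theorem AnalyticAt.fst_comp {f : X → Y × Z} {x : X} (h : AnalyticAt ℂ f x) :
    AnalyticAt ℂ (fun x => (f x).1) x := analyticAt_fst.comp h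

@[fun_prop]
theorem AnalyticAt.snd_comp {f : X → Y × Z} {x : X} (h : AnalyticAt ℂ f x) :
    AnalyticAt ℂ (fun x => (f x).2) x := analyticAt_snd.comp h

end FunProp

/-- The monic polynomial function with lower coefficients `a`. -/
def monicFn {d : ℕ} (a : Fin d → ℂ) (t : ℂ) : ℂ := t ^ d + ∑ j, a j * t ^ (j : ℕ)

/-- Coefficients of `(monicFn a s - monicFn a t) / (s - t)` as a polynomial in `t`. -/
def monicQuot {d : ℕ} (a : Fin d → ℂ) (s : ℂ) (i : Fin d) : ℂ :=
  s ^ (d - 1 - i) + ∑ k : Fin d, a k * if (i : ℕ) < k then s ^ ((k : ℕ) - 1 - i) else 0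

theorem pow_sub_pow_eq_sum_fin {d k : ℕ} (hk : k ≤ d) (s t : ℂ) :
    s ^ k - t ^ k = (s - t) * ∑ i : Fin d, (if (i : ℕ) < k then s ^ (k - 1 - i) else 0) * t ^ (i : ℕ) := by
  rw [Fin.sum_univ_eq_sum_range (fun i => (if i < k then s ^ (k - 1 - i) else 0) * t ^ i) d]
  have h1 : ∑ i ∈ Finset.range d, (if i < k then s ^ (k - 1 - i) else 0) * t ^ i
      = ∑ i ∈ Finset.range k, t ^ i * s ^ (k - 1 - i) := by
    symm
    rw [← Finset.sum_subset (Finset.range_mono hk)]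
    · refine Finset.sum_congr rfl fun i hi => ?_
      rw [if_pos (Finset.mem_range.1 hi), mul_comm]
    · intro i _ hi
      rw [if_neg (by simpa using hi), zero_mul]
  have h2 := geom_sum₂_mul t s k
  rw [h1]
  linear_combination h2

theorem monicFn_sub {d : ℕ} (a : Fin d → ℂ) (s t : ℂ) :
    monicFn a s - monicFn a t = (s - t) * ∑ i : Fin d, monicQuot a s i * t ^ (i : ℕ) := by
  have h : ∑ i : Fin d, monicQuot a s i * t ^ (i : ℕ)
      = (∑ i : Fin d, (if (i : ℕ) < d then s ^ (d - 1 - i) else 0) * t ^ (i : ℕ)) +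
        ∑ k : Fin d, a k *
          ∑ i : Fin d, (if (i : ℕ) < k then s ^ ((k : ℕ) - 1 - i) else 0) * t ^ (i : ℕ) := by
    simp only [monicQuot, add_mul, Finset.sum_add_distrib, Finset.sum_mul, Finset.mul_sum]
    congr 1
    · exact Finset.sum_congr rfl fun i _ => by rw [if_pos i.2]
    · rw [Finset.sum_comm]
      exact Finset.sum_congr rfl fun i _ => Finset.sum_congr rfl fun k _ => by rw [mul_assoc]
  rw [h, mul_add, ← pow_sub_pow_eq_sum_fin le_rfl, Finset.mul_sum]
  have h2 : ∀ k : Fin d, (s - t) * (a k *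
      ∑ i : Fin d, (if (i : ℕ) < k then s ^ ((k : ℕ) - 1 - i) else 0) * t ^ (i : ℕ))
      = a k * s ^ (k : ℕ) - a k * t ^ (k : ℕ) := fun k => by
    have := pow_sub_pow_eq_sum_fin k.2.le s t
    linear_combination -a k * this
  rw [Finset.sum_congr rfl fun k _ => h2 k, Finset.sum_sub_distrib]
  simp only [monicFn]
  ring

section Analytic

variable {X : Type*} [NormedAddCommGroup X] [NormedSpace ℂ X]

theorem analyticAt_monicFn {d : ℕ} {a : X → Fin d → ℂ} {t : X → ℂ} {x : X}
    (ha : AnalyticAt ℂ a x) (ht : AnalyticAt ℂ t x) :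
    AnalyticAt ℂ (fun y => monicFn (a y) (t y)) x := by
  rw [analyticAt_pi_iff] at ha
  unfold monicFn
  refine (ht.pow _).add (Finset.analyticAt_fun_sum _ fun j _ => (ha j).mul (ht.pow _))

theorem analyticAt_monicQuot {d : ℕ} {a : X → Fin d → ℂ} {t : X → ℂ} {x : X}
    (ha : AnalyticAt ℂ a x) (ht : AnalyticAt ℂ t x) (i : Fin d) :
    AnalyticAt ℂ (fun y => monicQuot (a y) (t y) i) x := by
  rw [analyticAt_pi_iff] at ha
  unfold monicQuot
  refine (ht.pow _).add (Finset.analyticAt_fun_sum _ fun j _ => (ha j).mul ?_)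
  split_ifs
  · exact ht.pow _
  · exact analyticAt_const

end Analytic

/-- Weierstrass division by the generic monic polynomial of degree `d`. -/
theorem exists_generic_division {E : Type*} [NormedAddCommGroup E] [NormedSpace ℂ E]
    [FiniteDimensional ℂ E] (d : ℕ) {G : E × ℂ → ℂ} (hG : AnalyticAt ℂ G 0) :
    ∃ (Q : ((Fin d → ℂ) × E) × ℂ → ℂ) (r : (Fin d → ℂ) × E → Fin d → ℂ),
      AnalyticAt ℂ Q 0 ∧ AnalyticAt ℂ r 0 ∧
      ∀ᶠ y in 𝓝 (0 : ((Fin d → ℂ) × E) × ℂ), G (y.1.2, y.2) =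
        Q y * monicFn y.1.1 y.2 + ∑ j, r y.1 j * y.2 ^ (j : ℕ) := by
  obtain ⟨ε, hε, hball⟩ := Metric.eventually_nhds_iff_ball.1 hG.eventually_analyticAt
  obtain ⟨ρ, hρ, hρε⟩ : ∃ ρ : ℝ, 0 < ρ ∧ ρ < ε := ⟨ε / 2, by linarith, by linarith⟩
  have hGs : ∀ s ∈ Metric.closedBall (0 : ℂ) ρ, AnalyticAt ℂ G (0, s) := fun s hs =>
    hball _ (by
      rw [mem_closedBall_zero_iff] at hs
      rw [mem_ball_zero_iff, Prod.norm_def]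
      simpa using hs.trans_lt hρε)
  have hsne : ∀ s ∈ Metric.sphere (0 : ℂ) ρ, s ≠ 0 := fun s hs => by
    rintro rfl
    simp at hs
    linarith
  have hmon : ∀ s ∈ Metric.sphere (0 : ℂ) ρ, monicFn (0 : Fin d → ℂ) s ≠ 0 := fun s hs => by
    simpa [monicFn] using fun h => absurd h (hsne s hs)
  let fQ : (((Fin d → ℂ) × E) × ℂ) × ℂ → ℂ := fun p =>
    G (p.1.1.2, p.2) / (monicFn p.1.1.1 p.2 * (p.2 - p.1.2))
  let fr : Fin d → ((Fin d → ℂ) × E) × ℂ → ℂ := fun j p =>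
    G (p.1.2, p.2) / monicFn p.1.1 p.2 * monicQuot p.1.1 p.2 j
  have hfQ : ∀ s ∈ Metric.sphere (0 : ℂ) ρ, AnalyticAt ℂ fQ (0, s) := fun s hs => by
    refine AnalyticAt.div ?_ (AnalyticAt.mul (analyticAt_monicFn (by fun_prop) (by fun_prop))
      (by fun_prop)) (mul_ne_zero (hmon s hs) (by simpa using hsne s hs))
    exact (hGs s (Metric.sphere_subset_closedBall hs)).comp_of_eq (by fun_prop) rfl
  have hfr : ∀ j, ∀ s ∈ Metric.sphere (0 : ℂ) ρ, AnalyticAt ℂ (fr j) (0, s) := fun j s hs => by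
    refine (AnalyticAt.div ?_ (analyticAt_monicFn (by fun_prop) (by fun_prop))
      (hmon s hs)).mul (analyticAt_monicQuot (by fun_prop) (by fun_prop) j)
    exact (hGs s (Metric.sphere_subset_closedBall hs)).comp_of_eq (by fun_prop) rfl
  refine ⟨fun y => (2 * Real.pi * I : ℂ)⁻¹ * ∮ s in C(0, ρ), fQ (y, s),
    fun x j => (2 * Real.pi * I : ℂ)⁻¹ * ∮ s in C(0, ρ), fr j (x, s),
    analyticAt_const.mul (analyticAt_circleIntegral hρ.le hfQ),
    analyticAt_pi_iff.2 fun j => analyticAt_const.mul (analyticAt_circleIntegral hρ.le (hfr j)), ?_⟩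
  have hev1 : ∀ᶠ y in 𝓝 (0 : ((Fin d → ℂ) × E) × ℂ), ∀ s ∈ Metric.closedBall (0 : ℂ) ρ,
      AnalyticAt ℂ G (y.1.2, s) := by
    refine (isCompact_closedBall _ _).eventually_forall_of_forall_eventually fun s hs => ?_
    have hc : ContinuousAt (fun z : (((Fin d → ℂ) × E) × ℂ) × ℂ => (z.1.1.2, z.2)) (0, s) := by
      fun_prop
    exact hc.eventually (hGs s hs).eventually_analyticAt
  have hev2 : ∀ᶠ y in 𝓝 (0 : ((Fin d → ℂ) × E) × ℂ), ∀ s ∈ Metric.sphere (0 : ℂ) ρ,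
      AnalyticAt ℂ fQ (y, s) ∧ (∀ j, AnalyticAt ℂ (fr j) (y.1, s)) ∧ monicFn y.1.1 s ≠ 0 := by
    refine (isCompact_sphere _ _).eventually_forall_of_forall_eventually fun s hs => ?_
    refine (hfQ s hs).eventually_analyticAt.and (Filter.Eventually.and ?_ ?_)
    · rw [Filter.eventually_all]
      intro j
      have hc : ContinuousAt (fun z : (((Fin d → ℂ) × E) × ℂ) × ℂ => (z.1.1, z.2)) (0, s) := by
        fun_prop
      exact hc.eventually (hfr j s hs).eventually_analyticAt
    · have hc : ContinuousAt (fun z : (((Fin d → ℂ) × E) × ℂ) × ℂ => monicFn z.1.1.1 z.2)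
          (0, s) := (analyticAt_monicFn (by fun_prop) (by fun_prop)).continuousAt
      exact hc.eventually_ne (hmon s hs)
  have hev3 : ∀ᶠ y in 𝓝 (0 : ((Fin d → ℂ) × E) × ℂ), y.2 ∈ Metric.ball (0 : ℂ) ρ :=
    (by fun_prop : ContinuousAt (fun y : ((Fin d → ℂ) × E) × ℂ => y.2) 0).eventually_mem
      (Metric.ball_mem_nhds _ hρ)
  filter_upwards [hev1, hev2, hev3] with y h1 h2 h3
  have hne : ∀ s ∈ Metric.sphere (0 : ℂ) ρ, s - y.2 ≠ 0 := by
    intro s hs h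
    rw [sub_eq_zero] at h
    rw [mem_sphere_iff_norm, h] at hs
    rw [mem_ball_iff_norm] at h3
    linarith
  have hdc : DiffContOnCl ℂ (fun s => G (y.1.2, s)) (Metric.ball 0 ρ) := by
    refine DifferentiableOn.diffContOnCl fun s hs => ?_
    exact ((h1 s (Metric.closure_ball_subset_closedBall hs)).comp_of_eq (f := fun s => (y.1.2, s))
      (by fun_prop) rfl).differentiableAt.differentiableWithinAt
  have hcQ : ContinuousOn (fun s => fQ (y, s)) (Metric.sphere 0 ρ) := fun s hs =>
    ((h2 s hs).1.comp_of_eq (f := fun s => (y, s))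
      (by fun_prop) rfl).continuousAt.continuousWithinAt
  have hcr : ∀ j, ContinuousOn (fun s => fr j (y.1, s)) (Metric.sphere 0 ρ) := fun j s hs =>
    (((h2 s hs).2.1 j).comp_of_eq (f := fun s => (y.1, s))
      (by fun_prop) rfl).continuousAt.continuousWithinAt
  have key : (∮ s in C(0, ρ), (s - y.2)⁻¹ • G (y.1.2, s)) =
      (∮ s in C(0, ρ), fQ (y, s)) * monicFn y.1.1 y.2 +
        ∑ j, (∮ s in C(0, ρ), fr j (y.1, s)) * y.2 ^ (j : ℕ) := by
    have e1 : (∮ s in C(0, ρ), (s - y.2)⁻¹ • G (y.1.2, s)) =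
        ∮ s in C(0, ρ), (monicFn y.1.1 y.2 * fQ (y, s) +
          ∑ j : Fin d, y.2 ^ (j : ℕ) * fr j (y.1, s)) := by
      refine circleIntegral.integral_congr hρ.le fun s hs => ?_
      have hm := (h2 s hs).2.2
      have hn := hne s hs
      have hs' := monicFn_sub y.1.1 s y.2
      have e2 : ∑ j : Fin d, y.2 ^ (j : ℕ) * fr j (y.1, s) =
          G (y.1.2, s) / monicFn y.1.1 s *
            ∑ j : Fin d, monicQuot y.1.1 s j * y.2 ^ (j : ℕ) := by
        rw [Finset.mul_sum]
        exact Finset.sum_congr rfl fun j _ => by simp only [fr]; ring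
      simp only [e2, fQ, smul_eq_mul]
      field_simp
      linear_combination (G (y.1.2, s)) * hs'
    rw [e1, circleIntegral.integral_add, circleIntegral.integral_const_mul,
      circleIntegral.integral_fun_sum, mul_comm]
    · congr 1
      refine Finset.sum_congr rfl fun j _ => ?_
      rw [circleIntegral.integral_const_mul, mul_comm]
    · exact fun j _ => (continuousOn_const.mul (hcr j)).circleIntegrable hρ.le
    · exact (continuousOn_const.mul hcQ).circleIntegrable hρ.le
    · exact (continuousOn_finsetSum _ fun j _ =>
        continuousOn_const.mul (hcr j)).circleIntegrable hρ.le
  have hcauchy := hdc.circleIntegral_sub_inv_smul h3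
  rw [key, smul_eq_mul] at hcauchy
  have h2pi : (2 * Real.pi * I : ℂ) ≠ 0 := by simp [Real.pi_ne_zero]
  have : G (y.1.2, y.2) = (2 * Real.pi * I : ℂ)⁻¹ * (2 * Real.pi * I * G (y.1.2, y.2)) := by
    field_simp
  rw [this, ← hcauchy, mul_add, Finset.mul_sum, mul_assoc]
  simp only [mul_assoc]

/-- A polynomial of degree `< d` divisible by `t ^ d` near `0` vanishes. -/
theorem eq_zero_of_sum_eq_pow_mul {d : ℕ} {c : Fin d → ℂ} {h : ℂ → ℂ} (hh : ContinuousAt h 0)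
    (hc : ∀ᶠ t in 𝓝[≠] (0 : ℂ), ∑ j, c j * t ^ (j : ℕ) = t ^ d * h t) : c = 0 := by
  by_contra hne
  set q : Polynomial ℂ := Polynomial.ofFn d c with hq
  have hq0 : q ≠ 0 := fun h0 => hne (Polynomial.injective_ofFn d (by rw [map_zero, ← h0]))
  obtain ⟨q1, hq1, hnd⟩ := Polynomial.exists_eq_pow_rootMultiplicity_mul_and_not_dvd q hq0 0
  set m := q.rootMultiplicity 0
  have hdeg : m < d := by
    have h1 : m ≤ q.natDegree := by
      have := Polynomial.natDegree_le_of_dvd (Polynomial.pow_rootMultiplicity_dvd q 0) hq0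
      rwa [Polynomial.natDegree_pow, Polynomial.natDegree_X_sub_C, mul_one] at this
    have h2 : q.natDegree < d := Polynomial.ofFn_natDegree_lt
      (Nat.one_le_iff_ne_zero.2 (Polynomial.ne_zero_of_ofFn_ne_zero hq0)) c
    omega
  have heval : ∀ t, ∑ j, c j * t ^ (j : ℕ) = t ^ m * q1.eval t := fun t => by
    have : q.eval t = ∑ j, c j * t ^ (j : ℕ) := by
      rw [hq, Polynomial.ofFn_eq_sum_monomial, Polynomial.eval_finsetSum]
      simp
    rw [← this, hq1]
    simp
  have h1 : Tendsto (fun t => q1.eval t) (𝓝[≠] (0 : ℂ)) (𝓝 (q1.eval 0)) :=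
    (q1.continuous.tendsto 0).mono_left nhdsWithin_le_nhds
  have h2 : Tendsto (fun t : ℂ => t ^ (d - m) * h t) (𝓝[≠] (0 : ℂ)) (𝓝 (0 ^ (d - m) * h 0)) :=
    (ContinuousAt.tendsto (by fun_prop)).mono_left nhdsWithin_le_nhds
  have h3 : (fun t => q1.eval t) =ᶠ[𝓝[≠] (0 : ℂ)] fun t => t ^ (d - m) * h t := by
    filter_upwards [hc, self_mem_nhdsWithin] with t ht ht0
    rw [heval] at ht
    refine mul_left_cancel₀ (pow_ne_zero m ht0) ?_
    rw [ht, ← mul_assoc, ← pow_add, Nat.add_sub_cancel' hdeg.le]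
  have h4 := tendsto_nhds_unique (h1.congr' h3) h2
  rw [zero_pow (by omega), zero_mul] at h4
  exact hnd (Polynomial.dvd_iff_isRoot.2 h4)

/-- Weierstrass preparation. -/
theorem exists_preparation {E : Type*} [NormedAddCommGroup E] [NormedSpace ℂ E]
    [FiniteDimensional ℂ E] {b : E × ℂ → ℂ} (hb : AnalyticAt ℂ b 0)
    (h0 : ¬ ∀ᶠ t in 𝓝 (0 : ℂ), b (0, t) = 0) :
    ∃ (d : ℕ) (a : E → Fin d → ℂ) (u : E × ℂ → ℂ), AnalyticAt ℂ a 0 ∧ a 0 = 0 ∧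
      AnalyticAt ℂ u 0 ∧ u 0 ≠ 0 ∧ ∀ᶠ y in 𝓝 (0 : E × ℂ), b y = u y * monicFn (a y.1) y.2 := by
  have hβ : AnalyticAt ℂ (fun t : ℂ => b (0, t)) 0 := hb.comp_of_eq (by fun_prop) rfl
  obtain ⟨d, g, hg, hg0, hbg⟩ := hβ.exists_eventuallyEq_pow_smul_nonzero_iff.2 h0
  obtain ⟨Q, r, hQ, hr, hdiv⟩ := exists_generic_division d hb
  have hline : ContinuousAt (fun t : ℂ => (((0 : Fin d → ℂ), (0 : E)), t)) 0 := by fun_prop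
  have hQline : AnalyticAt ℂ (fun t : ℂ => Q ((0, 0), t)) 0 := hQ.comp_of_eq (by fun_prop) rfl
  have hid : ∀ᶠ t in 𝓝 (0 : ℂ), t ^ d * g t = Q ((0, 0), t) * t ^ d +
      ∑ j, r (0, 0) j * t ^ (j : ℕ) := by
    filter_upwards [hline.eventually hdiv, hbg] with t h1 h2
    simp only [sub_zero, smul_eq_mul] at h2
    rw [← h2, h1]
    simp [monicFn]
  have hr0 : r (0, 0) = 0 := by
    refine eq_zero_of_sum_eq_pow_mul (h := fun t => g t - Q ((0, 0), t))
      (hg.continuousAt.sub hQline.continuousAt) ?_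
    filter_upwards [hid.filter_mono nhdsWithin_le_nhds] with t ht
    linear_combination -ht
  have hQ0 : Q 0 ≠ 0 := by
    have h1 : Tendsto (fun t => Q ((0, 0), t)) (𝓝[≠] (0 : ℂ)) (𝓝 (Q ((0, 0), 0))) :=
      hQline.continuousAt.tendsto.mono_left nhdsWithin_le_nhds
    have h2 : Tendsto g (𝓝[≠] (0 : ℂ)) (𝓝 (g 0)) :=
      hg.continuousAt.tendsto.mono_left nhdsWithin_le_nhds
    have h3 : (fun t => Q ((0, 0), t)) =ᶠ[𝓝[≠] (0 : ℂ)] g := by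
      filter_upwards [hid.filter_mono nhdsWithin_le_nhds, self_mem_nhdsWithin] with t ht ht0
      refine mul_left_cancel₀ (pow_ne_zero d ht0) ?_
      rw [ht, hr0]
      simp [mul_comm]
    have h4 := tendsto_nhds_unique (h1.congr' h3) h2
    exact fun h => hg0 (h4.symm.trans h)
  have hrd : DifferentiableAt ℂ r 0 := hr.differentiableAt
  have hinj : ∀ α : Fin d → ℂ, fderiv ℂ r 0 (α, 0) = 0 → α = 0 := by
    intro α hα
    have hQ' : AnalyticAt ℂ (fun t : ℂ => fderiv ℂ Q ((0, 0), t) ((α, 0), 0)) 0 :=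
      ((ContinuousLinearMap.apply ℂ ℂ (((α, 0), 0) : ((Fin d → ℂ) × E) × ℂ)).analyticAt _).comp
        (hQ.fderiv.comp_of_eq (f := fun t : ℂ => (((0 : Fin d → ℂ), (0 : E)), t))
          (by fun_prop) rfl)
    refine eq_zero_of_sum_eq_pow_mul
      (h := fun t => -fderiv ℂ Q ((0, 0), t) ((α, 0), 0) / Q ((0, 0), t))
      (hQ'.continuousAt.neg.div hQline.continuousAt hQ0) ?_
    refine Filter.Eventually.filter_mono nhdsWithin_le_nhds ?_
    filter_upwards [hline.eventually hdiv.eventually_nhds, hQline.continuousAt.eventually_ne hQ0,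
      hline.eventually hQ.eventually_analyticAt] with t h1 h2 h3
    have hc : HasDerivAt (fun ε : ℂ => (((ε • α, (0 : E)), t) : ((Fin d → ℂ) × E) × ℂ))
        ((α, 0), 0) 0 := by
      have := (hasDerivAt_id (0 : ℂ)).smul_const α
      rw [one_smul] at this
      exact (this.prodMk (hasDerivAt_const _ _)).prodMk (hasDerivAt_const _ _)
    have hc0 : (fun ε : ℂ => (((ε • α, (0 : E)), t) : ((Fin d → ℂ) × E) × ℂ)) 0
      = ((0, 0), t) := by simp
    have hQd : HasDerivAt (fun ε : ℂ => Q ((ε • α, 0), t))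
        (fderiv ℂ Q ((0, 0), t) ((α, 0), 0)) 0 :=
      HasFDerivAt.comp_hasDerivAt_of_eq 0 h3.differentiableAt.hasFDerivAt hc hc0.symm
    have hrder : HasDerivAt (fun ε : ℂ => r (ε • α, 0)) (fderiv ℂ r 0 (α, 0)) 0 := by
      refine HasFDerivAt.comp_hasDerivAt_of_eq 0 hrd.hasFDerivAt ?_ (by simp; rfl)
      have := (hasDerivAt_id (0 : ℂ)).smul_const α
      rw [one_smul] at this
      exact this.prodMk (hasDerivAt_const _ _)
    rw [hα, hasDerivAt_pi] at hrder
    have hmd : HasDerivAt (fun ε : ℂ => monicFn (ε • α) t) (∑ j, α j * t ^ (j : ℕ)) 0 := by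
      have : (fun ε : ℂ => monicFn (ε • α) t) =
          fun ε : ℂ => t ^ d + ε * ∑ j, α j * t ^ (j : ℕ) := by
        ext ε
        simp [monicFn, Finset.mul_sum, mul_assoc]
      rw [this]
      simpa using ((hasDerivAt_id (0 : ℂ)).mul_const (∑ j, α j * t ^ (j : ℕ))).const_add (t ^ d)
    have hsum : HasDerivAt (fun ε : ℂ => ∑ j, r (ε • α, 0) j * t ^ (j : ℕ)) 0 0 := by
      have := HasDerivAt.fun_sum (u := Finset.univ) fun j _ => (hrder j).mul_const (t ^ (j : ℕ))
      simpa using this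
    have hR := (hQd.mul hmd).add hsum
    have hL : HasDerivAt (fun _ : ℂ => b (0, t)) 0 0 := hasDerivAt_const _ _
    have hev : (fun _ : ℂ => b (0, t)) =ᶠ[𝓝 0] fun ε : ℂ => Q ((ε • α, 0), t) *
        monicFn (ε • α) t + ∑ j, r (ε • α, 0) j * t ^ (j : ℕ) := by
      rw [← hc0] at h1
      exact hc.continuousAt.eventually h1
    have huniq := hL.unique (hR.congr_of_eventuallyEq hev)
    simp only [zero_smul, monicFn, Pi.zero_apply, zero_mul, Finset.sum_const_zero, add_zero]
      at huniq
    field_simp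
    linear_combination huniq.symm
  let f : E × (Fin d → ℂ) → Fin d → ℂ := fun p => r (p.2, p.1)
  have hf : AnalyticAt ℂ f 0 := hr.comp_of_eq (by fun_prop) rfl
  have hfd : ∀ α, fderiv ℂ f 0 (0, α) = fderiv ℂ r 0 (α, 0) := fun α => by
    have h1 : HasFDerivAt f (fderiv ℂ r 0 ∘L
        ((ContinuousLinearMap.snd ℂ E (Fin d → ℂ)).prod
          (ContinuousLinearMap.fst ℂ E (Fin d → ℂ)))) 0 :=
      HasFDerivAt.comp (g := r) (0 : E × (Fin d → ℂ)) hrd.hasFDerivAt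
        (((ContinuousLinearMap.snd ℂ E (Fin d → ℂ)).prod
          (ContinuousLinearMap.fst ℂ E (Fin d → ℂ))).hasFDerivAt)
    rw [h1.fderiv]
    rfl
  have hinv : (fderiv ℂ f 0 ∘L .inr ℂ E (Fin d → ℂ)).IsInvertible := by
    have hi : Function.Injective (fderiv ℂ f 0 ∘L .inr ℂ E (Fin d → ℂ)).toLinearMap := by
      rw [injective_iff_map_eq_zero]
      intro α hα
      exact hinj α ((hfd α).symm.trans hα)
    exact ⟨(LinearEquiv.ofInjectiveEndo _ hi).toContinuousLinearEquiv, by ext; rfl⟩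
  have hcd : ContDiffAt ℂ ⊤ f 0 := hf.contDiffAt
  have hn : (⊤ : WithTop ℕ∞) ≠ 0 := by simp
  let a := hcd.implicitFunction hn hinv
  have ha0 : a 0 = 0 := hcd.implicitFunction_apply_self hn hinv
  have ha : AnalyticAt ℂ a 0 := by
    have := hcd.contDiffAt_implicitFunction hn hinv
    rw [← analyticWithinAt_univ]
    exact contDiffWithinAt_omega_iff_analyticWithinAt.1 this
  have har : ∀ᶠ x in 𝓝 (0 : E), r (a x, x) = 0 := by
    have := hcd.eventually_apply_implicitFunction hn hinv
    filter_upwards [this] with x hx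
    exact hx.trans hr0
  have hsub : AnalyticAt ℂ (fun y : E × ℂ => (((a y.1, y.1), y.2) : ((Fin d → ℂ) × E) × ℂ)) 0 :=
    ((ha.comp_of_eq (f := fun y : E × ℂ => y.1) (by fun_prop) rfl).prod (by fun_prop)).prod
      (by fun_prop)
  have hsub0 : (((a (0 : E × ℂ).1, (0 : E × ℂ).1), (0 : E × ℂ).2) : ((Fin d → ℂ) × E) × ℂ) = 0 := by
    simp [ha0]
  refine ⟨d, a, fun y => Q ((a y.1, y.1), y.2), ha, ha0, hQ.comp_of_eq hsub hsub0, ?_, ?_⟩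
  · simpa only [hsub0] using hQ0
  · have hc := hsub.continuousAt
    rw [ContinuousAt, hsub0] at hc
    filter_upwards [hc.eventually hdiv,
      (continuous_fst.tendsto' (0 : E × ℂ) (0 : E) rfl).eventually har] with y h1 h2
    rw [h1, h2]
    simp

/-- The monic polynomial of degree `d` with lower coefficients `a`. -/
def monicPoly {R : Type*} [CommRing R] [DecidableEq R] {d : ℕ} (a : Fin d → R) : Polynomial R :=
  Polynomial.X ^ d + Polynomial.ofFn d a

theorem monicPoly_monic {R : Type*} [CommRing R] [DecidableEq R] {d : ℕ} (a : Fin d → R) :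
    (monicPoly a).Monic :=
  Polynomial.monic_X_pow_add (Polynomial.ofFn_degree_lt a)

theorem monicPoly_natDegree {R : Type*} [CommRing R] [DecidableEq R] [Nontrivial R] {d : ℕ}
    (a : Fin d → R) : (monicPoly a).natDegree = d :=
  Polynomial.natDegree_eq_of_degree_eq_some
    ((Polynomial.degree_add_eq_left_of_degree_lt
      (by rw [Polynomial.degree_X_pow]; exact Polynomial.ofFn_degree_lt a)).trans
      (Polynomial.degree_X_pow d))

theorem eval_ofFn {d : ℕ} (c : Fin d → ℂ) (t : ℂ) :
    (Polynomial.ofFn d c).eval t = ∑ j, c j * t ^ (j : ℕ) := by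
  rw [Polynomial.ofFn_eq_sum_monomial, Polynomial.eval_finsetSum]
  simp

theorem eval_monicPoly {d : ℕ} (a : Fin d → ℂ) (t : ℂ) :
    (monicPoly a).eval t = monicFn a t := by
  simp [monicPoly, monicFn, eval_ofFn]

theorem exists_factor_ne_zero {p : Polynomial ℂ} (hp : p ≠ 0) (z : ℂ) :
    ∃ p1 : Polynomial ℂ, p1.eval z ≠ 0 ∧
      ∀ t, p.eval t = (t - z) ^ p.rootMultiplicity z * p1.eval t := by
  obtain ⟨p1, h1, h2⟩ := Polynomial.exists_eq_pow_rootMultiplicity_mul_and_not_dvd p hp z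
  refine ⟨p1, fun h => h2 (Polynomial.dvd_iff_isRoot.2 h), fun t => ?_⟩
  conv_lhs => rw [h1]
  simp

/-- A polynomial dividing another locally up to bounded factors divides it. -/
theorem Polynomial.dvd_of_norm_le {p q : Polynomial ℂ} (hp : p ≠ 0) {C : ℝ}
    (h : ∀ z, p.IsRoot z → ∀ᶠ t in 𝓝 z, ‖q.eval t‖ ≤ C * ‖p.eval t‖) : p ∣ q := by
  rcases eq_or_ne q 0 with rfl | hq
  · exact dvd_zero _
  refine (IsAlgClosed.splits p).dvd_of_roots_le_roots hp (Multiset.le_iff_count.2 fun z => ?_)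
  rw [count_roots, count_roots]
  by_contra! hlt
  have hroot : p.IsRoot z := (rootMultiplicity_pos hp).1 (by omega)
  obtain ⟨p1, -, hp1⟩ := exists_factor_ne_zero hp z
  obtain ⟨q1, hq1, hq1'⟩ := exists_factor_ne_zero hq z
  set m := p.rootMultiplicity z
  set k := q.rootMultiplicity z
  have hev : ∀ᶠ t in 𝓝[≠] z, ‖q1.eval t‖ ≤ C * (‖t - z‖ ^ (m - k) * ‖p1.eval t‖) := by
    filter_upwards [(h z hroot).filter_mono nhdsWithin_le_nhds, self_mem_nhdsWithin] with t ht htz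
    rw [hp1, hq1', norm_mul, norm_mul, norm_pow, norm_pow] at ht
    have hpos : 0 < ‖t - z‖ ^ k := pow_pos (norm_pos_iff.2 (sub_ne_zero.2 htz)) k
    refine le_of_mul_le_mul_left ?_ hpos
    calc _ ≤ _ := ht
      _ = _ := by
        rw [show m = k + (m - k) by omega, pow_add]
        simp only [add_tsub_cancel_left]
        ring
  have h1 : Tendsto (fun t => ‖q1.eval t‖) (𝓝[≠] z) (𝓝 ‖q1.eval z‖) :=
    (q1.continuous.norm.tendsto z).mono_left nhdsWithin_le_nhds
  have h2 : Tendsto (fun t => C * (‖t - z‖ ^ (m - k) * ‖p1.eval t‖)) (𝓝[≠] z)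
      (𝓝 (C * (‖z - z‖ ^ (m - k) * ‖p1.eval z‖))) :=
    ((by fun_prop : Continuous fun t => C * (‖t - z‖ ^ (m - k) * ‖p1.eval t‖)).tendsto z).mono_left
      nhdsWithin_le_nhds
  have h3 := le_of_tendsto_of_tendsto h1 h2 hev
  rw [sub_self, norm_zero, zero_pow (by omega), zero_mul, mul_zero] at h3
  exact hq1 (norm_le_zero_iff.1 h3)

theorem norm_root_lt {d : ℕ} {a : Fin d → ℂ} {t : ℂ} {ε : ℝ} (hε : 0 < ε) (hε1 : ε ≤ 1)
    (ha : ‖a‖ * d < ε ^ d) (ht : monicFn a t = 0) : ‖t‖ < ε := by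
  by_contra! hle
  have h1 : t ^ d = -∑ j, a j * t ^ (j : ℕ) := by
    rw [monicFn] at ht
    linear_combination ht
  have hd : ‖t‖ ^ d ≤ ‖a‖ * d * max 1 (‖t‖ ^ d) := by
    rw [← norm_pow]
    conv_lhs => rw [h1, norm_neg]
    rw [norm_pow]
    refine (norm_sum_le _ _).trans ?_
    have : ∀ j ∈ Finset.univ, ‖a j * t ^ ((j : Fin d) : ℕ)‖ ≤ ‖a‖ * max 1 (‖t‖ ^ d) := by
      intro j _
      rw [norm_mul, norm_pow]
      gcongr
      · exact norm_le_pi_norm a j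
      · rcases le_total ‖t‖ 1 with h | h
        · exact (pow_le_one₀ (norm_nonneg _) h).trans (le_max_left _ _)
        · exact (pow_le_pow_right₀ h j.2.le).trans (le_max_right _ _)
    refine (Finset.sum_le_card_nsmul _ _ _ this).trans_eq ?_
    simp
    ring
  have h2 : ε ^ d ≤ ‖t‖ ^ d := by gcongr
  have h3 : ε ^ d ≤ 1 := pow_le_one₀ hε.le hε1
  have h0 : 0 ≤ ‖a‖ * d := by positivity
  rcases le_total 1 (‖t‖ ^ d) with h | h
  · rw [max_eq_right h] at hd
    nlinarith
  · rw [max_eq_left h] at hd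
    nlinarith

/-- Uniqueness of the remainder in Weierstrass division. -/
theorem eventually_remainder_eq_zero {E : Type*} [NormedAddCommGroup E] {d : ℕ}
    {a c : E → Fin d → ℂ} {C : ℝ} (ha : ContinuousAt a 0) (ha0 : a 0 = 0)
    (h : ∀ᶠ y in 𝓝 (0 : E × ℂ), ‖∑ j, c y.1 j * y.2 ^ (j : ℕ)‖ ≤ C * ‖monicFn (a y.1) y.2‖) :
    ∀ᶠ x in 𝓝 (0 : E), c x = 0 := by
  obtain ⟨p, hp, q, hq, hpq⟩ := eventually_prod_iff.1 (by rwa [nhds_prod_eq] at h)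
  obtain ⟨ε, hε, hball⟩ := Metric.eventually_nhds_iff_ball.1 hq
  have hδ : 0 < min ε 1 := lt_min hε one_pos
  have hsmall : ∀ᶠ x in 𝓝 (0 : E), ‖a x‖ * d < min ε 1 ^ d := by
    have : ContinuousAt (fun x => ‖a x‖ * d) 0 := by fun_prop
    refine this.eventually_lt continuousAt_const ?_
    simp only [ha0, norm_zero, zero_mul]
    positivity
  filter_upwards [hp, hsmall] with x hx hxs
  have hdvd : monicPoly (a x) ∣ Polynomial.ofFn d (c x) := by
    refine Polynomial.dvd_of_norm_le (C := C) (monicPoly_monic _).ne_zero fun z hz => ?_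
    have hz' : ‖z‖ < ε :=
      (norm_root_lt hδ (min_le_right _ _) hxs ((eval_monicPoly _ _).symm.trans hz)).trans_le
        (min_le_left _ _)
    filter_upwards [Metric.isOpen_ball.mem_nhds (mem_ball_zero_iff.2 hz')] with t ht
    rw [eval_ofFn, eval_monicPoly]
    exact hpq hx (hball t ht)
  have := Polynomial.eq_zero_of_dvd_of_degree_lt hdvd (by
    rw [(Polynomial.degree_eq_natDegree (monicPoly_monic (a x)).ne_zero), monicPoly_natDegree]
    exact Polynomial.ofFn_degree_lt _)
  exact Polynomial.injective_ofFn d (by rw [this, map_zero])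

section Identity

variable {E : Type*} [NormedAddCommGroup E] [NormedSpace ℂ E]

theorem AnalyticAt.exists_ball {F : Type*} [NormedAddCommGroup F] [NormedSpace ℂ F]
    [CompleteSpace F] {f : E → F} {x : E} (hf : AnalyticAt ℂ f x) :
    ∃ ε > 0, AnalyticOnNhd ℂ f (Metric.ball x ε) := by
  obtain ⟨ε, hε, h⟩ := Metric.eventually_nhds_iff_ball.1 hf.eventually_analyticAt
  exact ⟨ε, hε, h⟩

theorem AnalyticOnNhd.eqOn_zero_ball {f : E → ℂ} {x y : E} {ε : ℝ}
    (hf : AnalyticOnNhd ℂ f (Metric.ball x ε)) (hy : y ∈ Metric.ball x ε)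
    (h : ∀ᶠ z in 𝓝 y, f z = 0) : ∀ z ∈ Metric.ball x ε, f z = 0 := by
  let : NormedSpace ℝ E := NormedSpace.restrictScalars ℝ ℂ E
  exact hf.eqOn_zero_of_preconnected_of_eventuallyEq_zero
    (convex_ball x ε).isPreconnected hy h

theorem AnalyticAt.eventually_zero_or {f g : E → ℂ} {x : E} (hf : AnalyticAt ℂ f x)
    (hg : AnalyticAt ℂ g x) (h : ∀ᶠ z in 𝓝 x, f z * g z = 0) :
    (∀ᶠ z in 𝓝 x, f z = 0) ∨ ∀ᶠ z in 𝓝 x, g z = 0 := by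
  obtain ⟨ε, hε, hball⟩ := Metric.eventually_nhds_iff_ball.1
    ((hf.eventually_analyticAt.and hg.eventually_analyticAt).and h)
  by_cases hz : ∀ z ∈ Metric.ball x ε, f z = 0
  · exact Or.inl (Metric.eventually_nhds_iff_ball.2 ⟨ε, hε, hz⟩)
  push Not at hz
  obtain ⟨y, hy, hfy⟩ := hz
  refine Or.inr (Metric.eventually_nhds_iff_ball.2 ⟨ε, hε, ?_⟩)
  refine AnalyticOnNhd.eqOn_zero_ball (fun z hz => (hball z hz).1.2) hy ?_
  filter_upwards [(hball y hy).1.1.continuousAt.eventually_ne hfy,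
    Metric.isOpen_ball.mem_nhds hy] with z h1 h2
  exact (mul_eq_zero.1 (hball z h2).2).resolve_left h1

/-- A nonzero germ is nonzero along some line. -/
theorem AnalyticAt.exists_line {f : E → ℂ} {x : E} (hf : AnalyticAt ℂ f x)
    (h : ¬ ∀ᶠ z in 𝓝 x, f z = 0) : ∃ v : E, ¬ ∀ᶠ t in 𝓝 (0 : ℂ), f (x + t • v) = 0 := by
  obtain ⟨ε, hε, hball⟩ := hf.exists_ball
  by_contra! hall
  refine h (Metric.eventually_nhds_iff_ball.2 ⟨ε, hε, fun y hy => ?_⟩)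
  let S : Set ℂ := (fun t : ℂ => x + t • (y - x)) ⁻¹' Metric.ball x ε
  let : NormedSpace ℝ E := NormedSpace.restrictScalars ℝ ℂ E
  have hS : Convex ℝ S := by
    have h2 : S = ((LinearMap.toSpanSingleton ℂ E (y - x)).restrictScalars ℝ) ⁻¹'
        (Metric.ball 0 ε) := by
      ext t
      simp [S]
    rw [h2]
    exact (convex_ball _ _).linear_preimage _
  have hana : AnalyticOnNhd ℂ (fun t : ℂ => f (x + t • (y - x))) S := fun t ht =>
    (hball _ ht).comp_of_eq (by fun_prop) rfl
  have h1 : (1 : ℂ) ∈ S := by simpa [S] using hy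
  have := hana.eqOn_zero_of_preconnected_of_eventuallyEq_zero hS.isPreconnected
    (show (0 : ℂ) ∈ S by simpa [S] using hε) (hall (y - x)) h1
  simpa using this

end Identity

theorem exists_equiv_prod {E : Type*} [NormedAddCommGroup E] [NormedSpace ℂ E]
    [FiniteDimensional ℂ E] {v : E} (hv : v ≠ 0) :
    ∃ (n : ℕ) (e : ((Fin n → ℂ) × ℂ) ≃L[ℂ] E), Module.finrank ℂ E = n + 1 ∧
      ∀ t, e (0, t) = t • v := by
  obtain ⟨W, hW⟩ := Submodule.exists_isCompl (Submodule.span ℂ {v})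
  have hfr : Module.finrank ℂ E = Module.finrank ℂ W + 1 := by
    rw [← Submodule.finrank_add_eq_of_isCompl hW, finrank_span_singleton hv, add_comm]
  let e1 : (Fin (Module.finrank ℂ W) → ℂ) ≃ₗ[ℂ] W := LinearEquiv.ofFinrankEq _ _ (by simp)
  let e : ((Fin (Module.finrank ℂ W) → ℂ) × ℂ) ≃ₗ[ℂ] E :=
    (LinearEquiv.prodCongr e1 (LinearEquiv.toSpanNonzeroSingleton ℂ E v hv)).trans
      (Submodule.prodEquivOfIsCompl W _ hW.symm)
  refine ⟨_, e.toContinuousLinearEquiv, hfr, fun t => ?_⟩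
  change e (0, t) = _
  simp [e]

/-- Weierstrass division by a distinguished monic polynomial. -/
theorem exists_division {E : Type*} [NormedAddCommGroup E] [NormedSpace ℂ E]
    [FiniteDimensional ℂ E] {d : ℕ} {a : E → Fin d → ℂ} (ha : AnalyticAt ℂ a 0) (ha0 : a 0 = 0)
    {G : E × ℂ → ℂ} (hG : AnalyticAt ℂ G 0) :
    ∃ (Q : E × ℂ → ℂ) (r : E → Fin d → ℂ), AnalyticAt ℂ Q 0 ∧ AnalyticAt ℂ r 0 ∧
      ∀ᶠ y in 𝓝 (0 : E × ℂ), G y = Q y * monicFn (a y.1) y.2 + ∑ j, r y.1 j * y.2 ^ (j : ℕ) := by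
  obtain ⟨Q, r, hQ, hr, hdiv⟩ := exists_generic_division d hG
  have hsub : AnalyticAt ℂ (fun y : E × ℂ => (((a y.1, y.1), y.2) : ((Fin d → ℂ) × E) × ℂ)) 0 :=
    ((ha.comp_of_eq (f := fun y : E × ℂ => y.1) (by fun_prop) rfl).prod (by fun_prop)).prod
      (by fun_prop)
  have hsub0 : (((a (0 : E × ℂ).1, (0 : E × ℂ).1), (0 : E × ℂ).2) : ((Fin d → ℂ) × E) × ℂ) = 0 := by
    simp [ha0]
  refine ⟨fun y => Q ((a y.1, y.1), y.2), fun x => r (a x, x), hQ.comp_of_eq hsub hsub0,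
    hr.comp_of_eq (ha.prod analyticAt_id) (by simp [ha0]), ?_⟩
  have hc := hsub.continuousAt
  rw [ContinuousAt, hsub0] at hc
  exact hc.eventually hdiv

/-- An analytic function dominated by another one is a multiple of it. -/
theorem AnalyticAt.exists_eq_mul_of_norm_le {E : Type*} [NormedAddCommGroup E] [NormedSpace ℂ E]
    [FiniteDimensional ℂ E] {a b : E → ℂ} (ha : AnalyticAt ℂ a 0) (hb : AnalyticAt ℂ b 0)
    (hb0 : ¬ ∀ᶠ x in 𝓝 0, b x = 0) {C : ℝ} (h : ∀ᶠ x in 𝓝 0, ‖a x‖ ≤ C * ‖b x‖) :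
    ∃ q : E → ℂ, AnalyticAt ℂ q 0 ∧ ∀ᶠ x in 𝓝 0, a x = b x * q x := by
  by_cases hz : b 0 = 0
  swap
  · refine ⟨fun x => a x / b x, ha.div hb hz, ?_⟩
    filter_upwards [hb.continuousAt.eventually_ne hz] with x hx
    field_simp
  obtain ⟨v, hv⟩ := hb.exists_line hb0
  have hv0 : v ≠ 0 := by
    rintro rfl
    simp [hz] at hv
  obtain ⟨n, e, -, he⟩ := exists_equiv_prod hv0
  have hae : AnalyticAt ℂ (a ∘ e) 0 := ha.comp_of_eq (e.analyticAt 0) (map_zero e)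
  have hbe : AnalyticAt ℂ (b ∘ e) 0 := hb.comp_of_eq (e.analyticAt 0) (map_zero e)
  obtain ⟨d, α, u, hα, hα0, hu, hu0, hbu⟩ := exists_preparation hbe (by simpa [he] using hv)
  obtain ⟨Q, r, hQ, hr, hdiv⟩ := exists_division hα hα0 hae
  have het : Tendsto e (𝓝 0) (𝓝 0) := e.continuous.tendsto' _ _ (map_zero e)
  obtain ⟨M, hM⟩ : ∃ M, ∀ᶠ y in 𝓝 (0 : (Fin n → ℂ) × ℂ), C * ‖u y‖ + ‖Q y‖ ≤ M := by
    refine ⟨C * ‖u 0‖ + ‖Q 0‖ + 1, ?_⟩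
    have : ContinuousAt (fun y => C * ‖u y‖ + ‖Q y‖) 0 :=
      (continuousAt_const.mul hu.continuousAt.norm).add hQ.continuousAt.norm
    exact (this.eventually_lt continuousAt_const (lt_add_one _)).mono fun y hy => hy.le
  have hr0 : ∀ᶠ x in 𝓝 (0 : Fin n → ℂ), r x = 0 := by
    refine eventually_remainder_eq_zero (C := M) hα.continuousAt hα0 ?_
    filter_upwards [het.eventually h, hbu, hdiv, hM] with y h1 h2 h3 h4
    have h5 : ∑ j, r y.1 j * y.2 ^ (j : ℕ) = a (e y) - Q y * monicFn (α y.1) y.2 := by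
      simp only [Function.comp] at h3
      rw [h3]; ring
    simp only [Function.comp] at h2
    rw [h5]
    rw [h2, norm_mul] at h1
    calc _ ≤ ‖a (e y)‖ + ‖Q y * monicFn (α y.1) y.2‖ := norm_sub_le _ _
      _ ≤ C * (‖u y‖ * ‖monicFn (α y.1) y.2‖) + ‖Q y‖ * ‖monicFn (α y.1) y.2‖ := by
        rw [norm_mul (Q y)]; gcongr
      _ = (C * ‖u y‖ + ‖Q y‖) * ‖monicFn (α y.1) y.2‖ := by ring
      _ ≤ _ := by gcongr
  have hq : AnalyticAt ℂ (fun y => Q y / u y) 0 := hQ.div hu hu0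
  refine ⟨fun x => (fun y => Q y / u y) (e.symm x),
    hq.comp_of_eq (e.symm.analyticAt 0) (map_zero e.symm), ?_⟩
  have hest : Tendsto e.symm (𝓝 0) (𝓝 0) := e.symm.continuous.tendsto' _ _ (map_zero e.symm)
  have hfst : Tendsto (fun y : (Fin n → ℂ) × ℂ => y.1) (𝓝 0) (𝓝 0) :=
    continuous_fst.tendsto' _ _ rfl
  filter_upwards [hest.eventually hbu, hest.eventually hdiv, hest.eventually (hfst.eventually hr0),
    hest.eventually (hu.continuousAt.eventually_ne hu0)] with x h1 h2 h3 h4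
  simp only [Function.comp, e.apply_symm_apply] at h1 h2
  rw [h2, h1, h3]
  simp
  field_simp

/-- The ring of germs of analytic functions at the origin. -/
def germRing (E : Type*) [NormedAddCommGroup E] [NormedSpace ℂ E] :
    Subring (Germ (𝓝 (0 : E)) ℂ) where
  carrier := {g | ∃ f : E → ℂ, AnalyticAt ℂ f 0 ∧ g = (f : Germ (𝓝 (0 : E)) ℂ)}
  mul_mem' := by
    rintro _ _ ⟨f, hf, rfl⟩ ⟨g, hg, rfl⟩
    exact ⟨f * g, hf.mul hg, rfl⟩
  one_mem' := ⟨1, analyticAt_const, rfl⟩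
  add_mem' := by
    rintro _ _ ⟨f, hf, rfl⟩ ⟨g, hg, rfl⟩
    exact ⟨f + g, hf.add hg, rfl⟩
  zero_mem' := ⟨0, analyticAt_const, rfl⟩
  neg_mem' := by
    rintro _ ⟨f, hf, rfl⟩
    exact ⟨-f, hf.neg, rfl⟩

section GermRing

variable {E : Type*} [NormedAddCommGroup E] [NormedSpace ℂ E]

/-- The germ of an analytic function. -/
def mkGerm (f : E → ℂ) (hf : AnalyticAt ℂ f 0) : germRing E := ⟨f, f, hf, rfl⟩

theorem exists_mkGerm (g : germRing E) : ∃ f hf, mkGerm f hf = g := by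
  obtain ⟨_, f, hf, rfl⟩ := g
  exact ⟨f, hf, rfl⟩

theorem mkGerm_eq {f g : E → ℂ} {hf : AnalyticAt ℂ f 0} {hg : AnalyticAt ℂ g 0} :
    mkGerm f hf = mkGerm g hg ↔ ∀ᶠ x in 𝓝 0, f x = g x :=
  Subtype.ext_iff.trans Germ.coe_eq

theorem mkGerm_eq_zero {f : E → ℂ} {hf : AnalyticAt ℂ f 0} :
    mkGerm f hf = 0 ↔ ∀ᶠ x in 𝓝 0, f x = 0 :=
  mkGerm_eq (hg := analyticAt_const (v := (0 : ℂ)))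

theorem mkGerm_mul {f g : E → ℂ} (hf : AnalyticAt ℂ f 0) (hg : AnalyticAt ℂ g 0) :
    mkGerm f hf * mkGerm g hg = mkGerm (fun x => f x * g x) (hf.mul hg) := rfl

theorem mkGerm_add {f g : E → ℂ} (hf : AnalyticAt ℂ f 0) (hg : AnalyticAt ℂ g 0) :
    mkGerm f hf + mkGerm g hg = mkGerm (fun x => f x + g x) (hf.add hg) := rfl

theorem mkGerm_pow {f : E → ℂ} (hf : AnalyticAt ℂ f 0) (n : ℕ) :
    mkGerm f hf ^ n = mkGerm (fun x => f x ^ n) (hf.pow n) := rfl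

theorem mkGerm_sum {ι : Type*} (s : Finset ι) {f : ι → E → ℂ} (hf : ∀ i, AnalyticAt ℂ (f i) 0) :
    ∑ i ∈ s, mkGerm (f i) (hf i) =
      mkGerm (fun x => ∑ i ∈ s, f i x) (Finset.analyticAt_fun_sum _ fun i _ => hf i) := by
  classical
  induction s using Finset.induction_on with
  | empty => exact (mkGerm_eq_zero.2 (by simp)).symm
  | insert i s hi ih =>
    rw [Finset.sum_insert hi, ih, mkGerm_add, mkGerm_eq]
    exact Eventually.of_forall fun x => (Finset.sum_insert (f := fun i => f i x) hi).symm

instance : Nontrivial (germRing E) :=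
  ⟨0, 1, fun h => by
    have h1 : mkGerm (fun _ : E => (1 : ℂ)) analyticAt_const = 0 := h.symm
    rw [mkGerm_eq_zero] at h1
    simpa using h1.self_of_nhds⟩

instance : IsDomain (germRing E) :=
  have : NoZeroDivisors (germRing E) := ⟨fun {a b} h => by
    obtain ⟨f, hf, rfl⟩ := exists_mkGerm a
    obtain ⟨g, hg, rfl⟩ := exists_mkGerm b
    rw [mkGerm_mul, mkGerm_eq_zero] at h
    rw [mkGerm_eq_zero, mkGerm_eq_zero]
    exact hf.eventually_zero_or hg h⟩
  NoZeroDivisors.to_isDomain _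

/-- Evaluation at the origin. -/
def germEval (E : Type*) [NormedAddCommGroup E] [NormedSpace ℂ E] : germRing E →+* ℂ :=
  (Germ.valueRingHom (X := E) (E := ℂ) (x := 0)).comp (germRing E).subtype

theorem germEval_mkGerm {f : E → ℂ} (hf : AnalyticAt ℂ f 0) : germEval E (mkGerm f hf) = f 0 := rfl

theorem dvd_of_norm_le [FiniteDimensional ℂ E] {f g : E → ℂ} (hf : AnalyticAt ℂ f 0)
    (hg : AnalyticAt ℂ g 0) (hg0 : mkGerm g hg ≠ 0) {C : ℝ}
    (h : ∀ᶠ x in 𝓝 0, ‖f x‖ ≤ C * ‖g x‖) : mkGerm g hg ∣ mkGerm f hf := by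
  obtain ⟨q, hq, hq'⟩ := hf.exists_eq_mul_of_norm_le hg (fun h => hg0 (mkGerm_eq_zero.2 h)) h
  exact ⟨mkGerm q hq, by rw [mkGerm_mul, mkGerm_eq]; exact hq'⟩

end GermRing

theorem norm_le_of_homogeneous_sum_eq_zero {n : ℕ} {c : ℕ → ℂ} {a b : ℂ} {M : ℝ} (hM : 0 ≤ M)
    (hc : ∀ i < n, ‖c i‖ ≤ M) (hn : c n = 1)
    (h : ∑ i ∈ Finset.range (n + 1), c i * b ^ (n - i) * a ^ i = 0) :
    ‖a‖ ≤ (1 + n * M) * ‖b‖ := by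
  by_contra! hlt
  have hb0 := norm_nonneg b
  have hnM : 0 ≤ n * M * ‖b‖ := by positivity
  have hba : ‖b‖ ≤ ‖a‖ := by nlinarith
  have ha : 0 < ‖a‖ := by nlinarith
  rw [Finset.sum_range_succ, hn, Nat.sub_self, pow_zero, mul_one, one_mul] at h
  have h1 : ‖a‖ ^ n ≤ n * (M * ‖b‖ * ‖a‖ ^ (n - 1)) := by
    rw [← norm_pow, eq_neg_of_add_eq_zero_right h, norm_neg]
    suffices ∀ i ∈ Finset.range n, ‖c i * b ^ (n - i) * a ^ i‖ ≤ M * ‖b‖ * ‖a‖ ^ (n - 1) by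
      simpa using norm_sum_le_of_le _ this
    intro i hi
    have hi := Finset.mem_range.1 hi
    rw [norm_mul, norm_mul, norm_pow, norm_pow]
    calc ‖c i‖ * ‖b‖ ^ (n - i) * ‖a‖ ^ i
        = ‖c i‖ * (‖b‖ * ‖b‖ ^ (n - 1 - i)) * ‖a‖ ^ i := by
          rw [← pow_succ', show n - 1 - i + 1 = n - i by omega]
      _ ≤ M * (‖b‖ * ‖a‖ ^ (n - 1 - i)) * ‖a‖ ^ i := by gcongr; exact hc i hi
      _ = M * ‖b‖ * (‖a‖ ^ (n - 1 - i) * ‖a‖ ^ i) := by ring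
      _ = _ := by rw [← pow_add, show n - 1 - i + i = n - 1 by omega]
  rcases Nat.eq_zero_or_pos n with rfl | hpos
  · simp at h1
    linarith
  · have h2 : ‖a‖ ^ n = ‖a‖ * ‖a‖ ^ (n - 1) := by
      rw [← pow_succ', Nat.sub_add_cancel hpos]
    have h3 : 0 < ‖a‖ ^ (n - 1) := by positivity
    rw [h2, show n * (M * ‖b‖ * ‖a‖ ^ (n - 1)) = (n * M * ‖b‖) * ‖a‖ ^ (n - 1) by ring] at h1
    have := le_of_mul_le_mul_right h1 h3
    nlinarith

theorem AnalyticAt.eventually_norm_le {E : Type*} [NormedAddCommGroup E] [NormedSpace ℂ E]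
    {f : E → ℂ} {x : E} (hf : AnalyticAt ℂ f x) : ∀ᶠ y in 𝓝 x, ‖f y‖ ≤ ‖f x‖ + 1 :=
  (hf.continuousAt.norm.eventually_lt continuousAt_const (lt_add_one _)).mono fun _ h => h.le

instance germRing.isIntegrallyClosed {E : Type*} [NormedAddCommGroup E] [NormedSpace ℂ E]
    [FiniteDimensional ℂ E] : IsIntegrallyClosed (germRing E) := by
  rw [isIntegrallyClosed_iff (FractionRing (germRing E))]
  rintro x ⟨p, hp, hx⟩
  obtain ⟨a, ⟨b, hb⟩, rfl⟩ := IsLocalization.exists_mk'_eq (nonZeroDivisors (germRing E)) x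
  have hb0 : b ≠ 0 := nonZeroDivisors.ne_zero hb
  have h1 := Polynomial.scaleRoots_eval₂_eq_zero (s := b) _ hx
  rw [IsLocalization.mk'_spec' (FractionRing (germRing E)) a ⟨b, hb⟩,
    Polynomial.eval₂_at_apply] at h1
  have h2 := (FaithfulSMul.algebraMap_injective (germRing E) (FractionRing (germRing E)))
    (h1.trans (map_zero _).symm)
  rw [Polynomial.eval_eq_sum_range,
    Polynomial.natDegree_scaleRoots] at h2
  simp only [Polynomial.coeff_scaleRoots] at h2
  obtain ⟨f, hf, rfl⟩ := exists_mkGerm a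
  obtain ⟨g, hg, rfl⟩ := exists_mkGerm b
  set n := p.natDegree
  have hrep : ∀ i, ∃ (γ : E → ℂ) (hγ : AnalyticAt ℂ γ 0), mkGerm γ hγ = p.coeff i :=
    fun i => exists_mkGerm _
  choose γ hγ hγp using hrep
  have hγn : ∀ᶠ x in 𝓝 0, γ n x = 1 := by
    have : mkGerm (γ n) (hγ n) = mkGerm (fun _ => 1) analyticAt_const := (hγp n).trans hp
    exact mkGerm_eq.1 this
  simp only [← hγp, mkGerm_pow, mkGerm_mul] at h2
  rw [mkGerm_sum (f := fun i x => γ i x * g x ^ (n - i) * f x ^ i) _ fun i =>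
    ((hγ i).mul (hg.pow (n - i))).mul (hf.pow i), mkGerm_eq_zero] at h2
  have hM : ∀ᶠ x in 𝓝 0, ∀ i < n, ‖γ i x‖ ≤ ∑ i ∈ Finset.range n, (‖γ i 0‖ + 1) := by
    have : ∀ᶠ x in 𝓝 0, ∀ i ∈ Finset.range n, ‖γ i x‖ ≤ ‖γ i 0‖ + 1 :=
      (Finset.eventually_all _).2 fun i _ => (hγ i).eventually_norm_le
    filter_upwards [this] with x hx i hi
    exact (hx i (Finset.mem_range.2 hi)).trans
      (Finset.single_le_sum (f := fun i => ‖γ i 0‖ + 1) (fun i _ => by positivity)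
        (Finset.mem_range.2 hi))
  have hM0 : 0 ≤ ∑ i ∈ Finset.range n, (‖γ i 0‖ + 1) := Finset.sum_nonneg fun i _ => by positivity
  obtain ⟨q, hq⟩ := dvd_of_norm_le hf hg hb0
    (C := 1 + n * ∑ i ∈ Finset.range n, (‖γ i 0‖ + 1)) (by
      filter_upwards [h2, hγn, hM] with x h2 h3 h4
      exact norm_le_of_homogeneous_sum_eq_zero (c := fun i => γ i x) hM0 h4 h3 h2)
  refine ⟨q, ?_⟩
  rw [eq_comm, IsLocalization.mk'_eq_iff_eq_mul, hq, map_mul, mul_comm]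

section EvalPolynomial

variable {E : Type*} [NormedAddCommGroup E] [NormedSpace ℂ E]

/-- Pullback of germs along the first projection. -/
def germPull (E : Type*) [NormedAddCommGroup E] [NormedSpace ℂ E] :
    germRing E →+* germRing (E × ℂ) where
  toFun g := ⟨g.1.compTendsto Prod.fst (continuous_fst.tendsto' (0 : E × ℂ) 0 rfl), by
    obtain ⟨_, f, hf, rfl⟩ := g
    exact ⟨fun y => f y.1, hf.comp_of_eq (f := fun y : E × ℂ => y.1) (by fun_prop) rfl, rfl⟩⟩
  map_one' := rfl
  map_zero' := rfl
  map_mul' := by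
    rintro ⟨_, f, hf, rfl⟩ ⟨_, g, hg, rfl⟩
    rfl
  map_add' := by
    rintro ⟨_, f, hf, rfl⟩ ⟨_, g, hg, rfl⟩
    rfl

theorem germPull_mkGerm {f : E → ℂ} (hf : AnalyticAt ℂ f 0) :
    germPull E (mkGerm f hf) =
      mkGerm (fun y => f y.1) (hf.comp_of_eq (f := fun y : E × ℂ => y.1) (by fun_prop) rfl) := rfl

/-- Polynomials over the germ ring as germs on the product with `ℂ`. -/
def germPoly (E : Type*) [NormedAddCommGroup E] [NormedSpace ℂ E] :
    Polynomial (germRing E) →+* germRing (E × ℂ) :=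
  Polynomial.eval₂RingHom (germPull E) (mkGerm (fun y => y.2) (by fun_prop))

theorem analyticAt_sum_mul_pow {d : ℕ} {c : E → Fin d → ℂ}
    (hc : ∀ j, AnalyticAt ℂ (fun x => c x j) 0) (j : Fin d) :
    AnalyticAt ℂ (fun y : E × ℂ => c y.1 j * y.2 ^ (j : ℕ)) 0 :=
  ((hc j).comp_of_eq (f := fun y : E × ℂ => y.1) (by fun_prop) rfl).mul (by fun_prop)

theorem analyticAt_monicFn_fst {d : ℕ} {a : E → Fin d → ℂ}
    (ha : ∀ j, AnalyticAt ℂ (fun x => a x j) 0) :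
    AnalyticAt ℂ (fun y : E × ℂ => monicFn (a y.1) y.2) 0 :=
  analyticAt_monicFn (AnalyticAt.comp_of_eq (g := a) (f := fun y : E × ℂ => y.1)
    (analyticAt_pi_iff.2 ha) (by fun_prop) rfl) (by fun_prop)

open Classical in
theorem germPoly_ofFn {d : ℕ} {c : E → Fin d → ℂ} (hc : ∀ j, AnalyticAt ℂ (fun x => c x j) 0) :
    germPoly E (Polynomial.ofFn d fun j => mkGerm _ (hc j)) =
      mkGerm (fun y => ∑ j, c y.1 j * y.2 ^ (j : ℕ))
        (Finset.analyticAt_fun_sum _ fun j _ => analyticAt_sum_mul_pow hc j) := by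
  rw [Polynomial.ofFn_eq_sum_monomial, map_sum, ← mkGerm_sum _ (analyticAt_sum_mul_pow hc)]
  refine Finset.sum_congr rfl fun j _ => ?_
  simp only [germPoly, Polynomial.coe_eval₂RingHom, Polynomial.eval₂_monomial, germPull_mkGerm,
    mkGerm_pow]
  rfl

open Classical in
theorem germPoly_monicPoly {d : ℕ} {a : E → Fin d → ℂ} (ha : ∀ j, AnalyticAt ℂ (fun x => a x j) 0) :
    germPoly E (monicPoly fun j => mkGerm _ (ha j)) =
      mkGerm (fun y => monicFn (a y.1) y.2) (analyticAt_monicFn_fst ha) := by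
  rw [monicPoly, map_add, germPoly_ofFn, map_pow]
  simp only [germPoly, Polynomial.coe_eval₂RingHom, Polynomial.eval₂_X, mkGerm_pow, mkGerm_add]
  rfl

open Classical in
/-- Monic polynomials over the germ ring are given by analytic coefficients. -/
theorem exists_monicPoly_eq {p : Polynomial (germRing E)} (hp : p.Monic) :
    ∃ (a : E → Fin p.natDegree → ℂ) (ha : ∀ j, AnalyticAt ℂ (fun x => a x j) 0),
      p = monicPoly fun j => mkGerm _ (ha j) := by
  have hrep : ∀ i, ∃ (γ : E → ℂ) (hγ : AnalyticAt ℂ γ 0), mkGerm γ hγ = p.coeff i :=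
    fun i => exists_mkGerm _
  choose γ hγ hγp using hrep
  refine ⟨fun x j => γ j x, fun j => hγ j, Polynomial.ext fun i => ?_⟩
  rw [monicPoly, Polynomial.coeff_add, Polynomial.coeff_X_pow]
  rcases lt_trichotomy i p.natDegree with h | h | h
  · rw [if_neg h.ne, zero_add, Polynomial.ofFn_coeff_eq_val_of_lt _ h, hγp]
  · rw [if_pos h, Polynomial.ofFn_coeff_eq_zero_of_ge _ h.ge, add_zero, h]
    exact hp
  · rw [if_neg h.ne', Polynomial.ofFn_coeff_eq_zero_of_ge _ h.le, zero_add,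
      Polynomial.coeff_eq_zero_of_natDegree_lt h]

open Classical in
/-- A monic divisor of a distinguished polynomial is distinguished. -/
theorem apply_zero_eq_zero_of_dvd {d m : ℕ} {a : E → Fin d → ℂ} {b : E → Fin m → ℂ}
    (ha : ∀ j, AnalyticAt ℂ (fun x => a x j) 0) (hb : ∀ j, AnalyticAt ℂ (fun x => b x j) 0)
    (ha0 : a 0 = 0)
    (h : (monicPoly fun j => mkGerm _ (hb j)) ∣ monicPoly fun j => mkGerm _ (ha j)) : b 0 = 0 := by
  have hmap : ∀ {k : ℕ} {c : E → Fin k → ℂ} (hc : ∀ j, AnalyticAt ℂ (fun x => c x j) 0),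
      (monicPoly fun j => mkGerm _ (hc j)).map (germEval E) =
        Polynomial.X ^ k + Polynomial.ofFn k (c 0) := by
    intro k c hc
    rw [monicPoly, Polynomial.map_add, Polynomial.map_pow, Polynomial.map_X]
    congr 1
    ext i
    rw [Polynomial.coeff_map]
    by_cases hi : i < k
    · rw [Polynomial.ofFn_coeff_eq_val_of_lt _ hi, Polynomial.ofFn_coeff_eq_val_of_lt _ hi,
        germEval_mkGerm]
    · rw [Polynomial.ofFn_coeff_eq_zero_of_ge _ (not_lt.1 hi),
        Polynomial.ofFn_coeff_eq_zero_of_ge _ (not_lt.1 hi), map_zero]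
  have h1 := Polynomial.map_dvd (germEval E) h
  rw [hmap ha, hmap hb, ha0, map_zero, add_zero] at h1
  obtain ⟨i, -, hi⟩ := (dvd_prime_pow Polynomial.prime_X _).1 h1
  have hmon : (Polynomial.X ^ m + Polynomial.ofFn m (b 0)).Monic :=
    Polynomial.monic_X_pow_add (Polynomial.ofFn_degree_lt _)
  have heq := Polynomial.eq_of_monic_of_associated hmon (Polynomial.monic_X_pow i) hi
  have hdeg : m = i := by
    have h2 := congrArg Polynomial.natDegree heq
    rw [Polynomial.natDegree_X_pow] at h2
    rw [← h2]
    exact (monicPoly_natDegree (b 0)).symm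
  subst hdeg
  have : Polynomial.ofFn m (b 0) = 0 := by simpa using heq
  exact Polynomial.injective_ofFn m (this.trans (map_zero _).symm)

end EvalPolynomial

attribute [local instance] Polynomial.algebra Polynomial.isLocalization in
/-- An ideal containing a monic polynomial either meets the constants, or all of its elements have
a common nonconstant monic divisor. -/
theorem Polynomial.exists_C_mem_or_exists_monic_dvd {R : Type*} [CommRing R] [IsDomain R]
    [IsIntegrallyClosed R] {J : Ideal (Polynomial R)} {P : Polynomial R} (hP : P.Monic)
    (hPJ : P ∈ J) :
    (∃ ρ : R, ρ ≠ 0 ∧ Polynomial.C ρ ∈ J) ∨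
      ∃ h : Polynomial R, h.Monic ∧ 0 < h.natDegree ∧ ∀ q ∈ J, h ∣ q := by
  let K := FractionRing R
  let φ := algebraMap R K
  have hφ : Function.Injective φ := FaithfulSMul.algebraMap_injective R K
  by_cases htop : J.map (Polynomial.mapRingHom φ) = ⊤
  · left
    have h1 := (IsLocalization.map_algebraMap_ne_top_iff_disjoint
      (S := Polynomial K) ((nonZeroDivisors R).map (Polynomial.C : R →+* Polynomial R)) J).not
    rw [not_ne_iff, Set.not_disjoint_iff] at h1
    obtain ⟨_, ⟨ρ, hρ, rfl⟩, hx⟩ := h1.1 htop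
    exact ⟨ρ, nonZeroDivisors.ne_zero hρ, hx⟩
  · right
    obtain ⟨g, hg⟩ := IsPrincipalIdealRing.principal (J.map (Polynomial.mapRingHom φ))
    have hdvd : ∀ q ∈ J, g ∣ q.map φ := fun q hq =>
      Ideal.mem_span_singleton.1 (by
        rw [← Ideal.submodule_span_eq, ← hg]
        exact Ideal.mem_map_of_mem (Polynomial.mapRingHom φ) hq)
    obtain ⟨h, hh⟩ := IsIntegrallyClosed.eq_map_mul_C_of_dvd K hP (hdvd P hPJ)
    have hg0 : g ≠ 0 := ne_zero_of_dvd_ne_zero (hP.map φ).ne_zero (hdvd P hPJ)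
    have hlc : g.leadingCoeff ≠ 0 := Polynomial.leadingCoeff_ne_zero.2 hg0
    have hmon : h.Monic := by
      have h1 := congrArg Polynomial.leadingCoeff hh
      rw [Polynomial.leadingCoeff_mul, Polynomial.leadingCoeff_C, mul_eq_right₀ hlc,
        Polynomial.leadingCoeff_map_of_injective hφ] at h1
      exact hφ (h1.trans (map_one φ).symm)
    refine ⟨h, hmon, Nat.pos_of_ne_zero fun h0 => htop ?_, fun q hq => ?_⟩
    · rw [Polynomial.eq_one_of_monic_natDegree_zero hmon h0, Polynomial.map_one, one_mul] at hh
      rw [hg, Ideal.submodule_span_eq, ← hh, Ideal.span_singleton_eq_top]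
      exact Polynomial.isUnit_C.2 hlc.isUnit
    · rw [← Polynomial.map_dvd_map φ hφ hmon]
      exact (Dvd.intro _ hh).trans (hdvd q hq)

/-- Germs of analytic functions vanishing on `Z` near the origin. -/
def vanishingIdeal {E : Type*} [NormedAddCommGroup E] [NormedSpace ℂ E] (Z : Set E) :
    Ideal (germRing E) where
  carrier := {g | ∃ f hf, mkGerm f hf = g ∧ ∀ᶠ z in 𝓝 0, z ∈ Z → f z = 0}
  zero_mem' := ⟨fun _ => 0, analyticAt_const, rfl, by simp⟩
  add_mem' := by
    rintro _ _ ⟨f, hf, rfl, h1⟩ ⟨g, hg, rfl, h2⟩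
    refine ⟨_, hf.add hg, rfl, ?_⟩
    filter_upwards [h1, h2] with z h1 h2 hz
    simp [h1 hz, h2 hz]
  smul_mem' := by
    rintro c _ ⟨f, hf, rfl, h1⟩
    obtain ⟨g, hg, rfl⟩ := exists_mkGerm c
    refine ⟨_, hg.mul hf, rfl, ?_⟩
    filter_upwards [h1] with z h1 hz
    simp [h1 hz]

theorem mkGerm_mem_vanishingIdeal {E : Type*} [NormedAddCommGroup E] [NormedSpace ℂ E]
    {Z : Set E} {f : E → ℂ} {hf : AnalyticAt ℂ f 0} :
    mkGerm f hf ∈ vanishingIdeal Z ↔ ∀ᶠ z in 𝓝 0, z ∈ Z → f z = 0 := by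
  refine ⟨fun ⟨g, hg, h1, h2⟩ => ?_, fun h => ⟨f, hf, rfl, h⟩⟩
  filter_upwards [mkGerm_eq.1 h1, h2] with z h1 h2 hz
  rw [← h1, h2 hz]

theorem mem_ball_prod_zero {E F : Type*} [SeminormedAddCommGroup E] [SeminormedAddCommGroup F]
    {ε : ℝ} {y : E × F} : y ∈ Metric.ball (0 : E × F) ε ↔
      y.1 ∈ Metric.ball (0 : E) ε ∧ y.2 ∈ Metric.ball (0 : F) ε := by
  simp [Prod.norm_def]

theorem AnalyticOnNhd.apply_eq_zero_of_eventually {E F : Type*} [NormedAddCommGroup E]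
    [NormedSpace ℂ E] [NormedAddCommGroup F] [NormedSpace ℂ F] {G : E × F → ℂ} {S : Set E} {ε : ℝ}
    (hG : AnalyticOnNhd ℂ G (S ×ˢ Metric.ball 0 ε)) {z : E} (hz : z ∈ S)
    (h : ∀ᶠ w in 𝓝 (0 : F), G (z, w) = 0) {w : F} (hw : w ∈ Metric.ball (0 : F) ε) :
    G (z, w) = 0 := by
  have hε : 0 < ε := (norm_nonneg w).trans_lt (mem_ball_zero_iff.1 hw)
  have h1 : AnalyticOnNhd ℂ (fun w => G (z, w)) (Metric.ball 0 ε) := fun w hw =>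
    (hG (z, w) ⟨hz, hw⟩).comp_of_eq (by fun_prop) rfl
  exact h1.eqOn_zero_ball (Metric.mem_ball_self hε) h w hw

open Classical in
theorem exists_factor_of_dvd {E F : Type*} [NormedAddCommGroup E] [NormedSpace ℂ E]
    [FiniteDimensional ℂ E] [NormedAddCommGroup F] [NormedSpace ℂ F] [FiniteDimensional ℂ F]
    {G : (E × ℂ) × F → ℂ} (hG : AnalyticAt ℂ G 0) {m : ℕ} {α : E → Fin m → ℂ}
    (hα : ∀ j, AnalyticAt ℂ (fun x => α x j) 0) (hα0 : α 0 = 0) {δ : ℝ} (hδ : 0 < δ)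
    (hdvd : ∀ w ∈ Metric.ball (0 : F) δ, ∃ c : E × ℂ → ℂ, AnalyticAt ℂ c 0 ∧
      ∀ᶠ z in 𝓝 (0 : E × ℂ), G (z, w) = c z * monicFn (α z.1) z.2) :
    ∃ G1 : (E × ℂ) × F → ℂ, AnalyticAt ℂ G1 0 ∧
      ∀ᶠ y in 𝓝 0, G y = monicFn (α y.1.1) y.1.2 * G1 y := by
  have hα' : AnalyticAt ℂ α 0 := analyticAt_pi_iff.2 hα
  obtain ⟨Q, s, hQ, hs, hdiv⟩ := exists_division (E := E × F) (a := fun x => α x.1)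
    (hα'.comp_of_eq (by fun_prop) rfl) hα0 (G := fun y => G ((y.1.1, y.2), y.1.2))
    (hG.comp_of_eq (by fun_prop) rfl)
  obtain ⟨ε, hε, hball⟩ := Metric.eventually_nhds_iff_ball.1
    ((hdiv.and hQ.eventually_analyticAt).and
      ((continuous_fst.tendsto' (0 : (E × F) × ℂ) 0 rfl).eventually hs.eventually_analyticAt))
  have hs0 : ∀ w ∈ Metric.ball (0 : F) (min ε δ), ∀ x ∈ Metric.ball (0 : E) ε, s (x, w) = 0 := by
    intro w hw
    have hwε : w ∈ Metric.ball (0 : F) ε := Metric.ball_subset_ball (min_le_left _ _) hw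
    have hmem : ((0, w), (0 : ℂ)) ∈ Metric.ball (0 : (E × F) × ℂ) ε :=
      mem_ball_prod_zero.2 ⟨mem_ball_prod_zero.2 ⟨Metric.mem_ball_self hε, hwε⟩,
        Metric.mem_ball_self hε⟩
    obtain ⟨c, hc, hGc⟩ := hdvd w (Metric.ball_subset_ball (min_le_right _ _) hw)
    have hQw : AnalyticAt ℂ (fun z : E × ℂ => Q ((z.1, w), z.2)) 0 :=
      (hball _ hmem).1.2.comp_of_eq (by fun_prop) rfl
    have hev : ∀ᶠ z in 𝓝 (0 : E × ℂ), z ∈ Metric.ball (0 : E × ℂ) ε := Metric.ball_mem_nhds _ hε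
    have hrem : ∀ᶠ x in 𝓝 (0 : E), s (x, w) = 0 := by
      refine eventually_remainder_eq_zero (c := fun x => s (x, w))
        (C := ‖c 0 - Q ((0, w), 0)‖ + 1) hα'.continuousAt hα0 ?_
      filter_upwards [hGc, hev, (hc.sub hQw).eventually_norm_le] with z h1 h2 h3
      have h2' := mem_ball_prod_zero.1 h2
      have h4 := (hball ((z.1, w), z.2) (mem_ball_prod_zero.2
        ⟨mem_ball_prod_zero.2 ⟨h2'.1, hwε⟩, h2'.2⟩)).1.1
      have h5 : ∑ j, s (z.1, w) j * z.2 ^ (j : ℕ) =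
          (c z - Q ((z.1, w), z.2)) * monicFn (α z.1) z.2 := by
        simp only [Prod.mk.eta, h1] at h4
        linear_combination -h4
      rw [h5, norm_mul]
      exact mul_le_mul_of_nonneg_right h3 (norm_nonneg _)
    intro x hx
    funext j
    have han : AnalyticOnNhd ℂ (fun x => s (x, w) j) (Metric.ball (0 : E) ε) := fun x hx => by
      have h6 := (hball ((x, w), 0) (mem_ball_prod_zero.2
        ⟨mem_ball_prod_zero.2 ⟨hx, hwε⟩, Metric.mem_ball_self hε⟩)).2
      exact (analyticAt_pi_iff.1 h6 j).comp_of_eq (f := fun x => (x, w)) (by fun_prop) rfl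
    exact han.eqOn_zero_ball (Metric.mem_ball_self hε) (hrem.mono fun x hx => congrFun hx j) x hx
  refine ⟨fun y => Q ((y.1.1, y.2), y.1.2), hQ.comp_of_eq (by fun_prop) rfl, ?_⟩
  filter_upwards [Metric.ball_mem_nhds (0 : (E × ℂ) × F) (lt_min hε hδ)] with y hy
  have hy1 := mem_ball_prod_zero.1 hy
  have hy2 := mem_ball_prod_zero.1 (Metric.ball_subset_ball (min_le_left _ _) hy1.1)
  have h1 := (hball ((y.1.1, y.2), y.1.2) (mem_ball_prod_zero.2 ⟨mem_ball_prod_zero.2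
    ⟨hy2.1, Metric.ball_subset_ball (min_le_left _ _) hy1.2⟩, hy2.2⟩)).1.1
  simp only [hs0 y.2 hy1.2 y.1.1 hy2.1, Prod.mk.eta, Pi.zero_apply, zero_mul,
    Finset.sum_const_zero, add_zero] at h1
  rw [h1, mul_comm]

open Classical in
theorem exists_factor_or_degenerate_subset_aux {E F : Type*} [NormedAddCommGroup E]
    [NormedSpace ℂ E] [FiniteDimensional ℂ E] [NormedAddCommGroup F] [NormedSpace ℂ F]
    [FiniteDimensional ℂ F] {G : (E × ℂ) × F → ℂ} {S : Set (E × ℂ)} (hS : S ∈ 𝓝 0) {ε : ℝ}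
    (hG : AnalyticOnNhd ℂ G (S ×ˢ Metric.ball 0 ε)) {w₁ : F} (hw₁ : w₁ ∈ Metric.ball (0 : F) ε)
    (hGw : ¬ ∀ᶠ t in 𝓝 (0 : ℂ), G ((0, t), w₁) = 0) :
    (∃ (h : E × ℂ → ℂ) (G1 : (E × ℂ) × F → ℂ), AnalyticAt ℂ h 0 ∧ AnalyticAt ℂ G1 0 ∧ h 0 = 0 ∧
      ∀ᶠ y in 𝓝 0, G y = h y.1 * G1 y) ∨
    ∃ ρ : E → ℂ, AnalyticAt ℂ ρ 0 ∧ (¬ ∀ᶠ x in 𝓝 0, ρ x = 0) ∧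
      ∀ᶠ z in 𝓝 (0 : E × ℂ), (∀ᶠ w in 𝓝 (0 : F), G (z, w) = 0) → ρ z.1 = 0 := by
  have hε : 0 < ε := (norm_nonneg w₁).trans_lt (mem_ball_zero_iff.1 hw₁)
  have hb : AnalyticAt ℂ (fun z => G (z, w₁)) 0 :=
    (hG (0, w₁) ⟨mem_of_mem_nhds hS, hw₁⟩).comp_of_eq
      (by fun_prop) rfl
  obtain ⟨d, a, u, ha, ha0, hu, hu0, hP⟩ := exists_preparation hb hGw
  have haj := analyticAt_pi_iff.1 ha
  have hG0 : AnalyticAt ℂ G 0 := hG 0 ⟨mem_of_mem_nhds hS, Metric.mem_ball_self hε⟩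
  obtain ⟨Q, r, hQ, hr, hdiv⟩ := exists_division (E := E × F) (a := fun x => a x.1)
    (ha.comp_of_eq (by fun_prop) rfl) ha0 (G := fun y => G ((y.1.1, y.2), y.1.2))
    (hG0.comp_of_eq (by fun_prop) rfl)
  obtain ⟨δ', hδ', hball'⟩ := Metric.eventually_nhds_iff_ball.1
    ((hdiv.and hQ.eventually_analyticAt).and
      ((continuous_fst.tendsto' (0 : (E × F) × ℂ) 0 rfl).eventually hr.eventually_analyticAt))
  obtain ⟨ε', hε', hεS⟩ := Metric.mem_nhds_iff.1 hS
  let δ := min δ' (min ε' ε)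
  have hδ : 0 < δ := lt_min hδ' (lt_min hε' hε)
  have hball : ∀ x ∈ Metric.ball (0 : E) δ, ∀ w ∈ Metric.ball (0 : F) δ,
      ∀ t ∈ Metric.ball (0 : ℂ) δ, (G ((x, t), w) = Q ((x, w), t) * monicFn (a x) t +
        ∑ j, r (x, w) j * t ^ (j : ℕ)) ∧ AnalyticAt ℂ Q ((x, w), t) ∧ AnalyticAt ℂ r (x, w) := by
    intro x hx w hw t ht
    have hsub := Metric.ball_subset_ball (x := (0 : (E × F) × ℂ)) (min_le_left δ' (min ε' ε))
    have := hball' ((x, w), t)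
      (hsub (mem_ball_prod_zero.2 ⟨mem_ball_prod_zero.2 ⟨hx, hw⟩, ht⟩))
    exact ⟨this.1.1, this.1.2, this.2⟩
  have hrw : ∀ w ∈ Metric.ball (0 : F) δ, ∀ j, AnalyticAt ℂ (fun x => r (x, w) j) 0 :=
    fun w hw j => (analyticAt_pi_iff.1 (hball 0 (Metric.mem_ball_self hδ) w hw 0
      (Metric.mem_ball_self hδ)).2.2 j).comp_of_eq (f := fun x => (x, w)) (by fun_prop) rfl
  let P : Polynomial (germRing E) := monicPoly fun j => mkGerm _ (haj j)
  let R : Metric.ball (0 : F) δ → Polynomial (germRing E) := fun w =>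
    Polynomial.ofFn d fun j => mkGerm _ (hrw w w.2 j)
  let J : Ideal (Polynomial (germRing E)) := Ideal.span (insert P (range R))
  have hPJ : P ∈ J := Ideal.subset_span (mem_insert _ _)
  have hRJ : ∀ w, R w ∈ J := fun w => Ideal.subset_span (mem_insert_of_mem _ (mem_range_self w))
  have hev : ∀ᶠ z in 𝓝 (0 : E × ℂ), z ∈ Metric.ball (0 : E × ℂ) δ := Metric.ball_mem_nhds _ hδ
  rcases Polynomial.exists_C_mem_or_exists_monic_dvd (monicPoly_monic _) hPJ with
    ⟨ρ, hρ0, hρ⟩ | ⟨h, hmon, hdeg, hdvd⟩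
  · right
    obtain ⟨ρ, hρa, rfl⟩ := exists_mkGerm ρ
    refine ⟨ρ, hρa, fun h => hρ0 (mkGerm_eq_zero.2 h), ?_⟩
    let Z : Set (E × ℂ) := {z | ∀ᶠ w in 𝓝 (0 : F), G (z, w) = 0}
    have hZ : ∀ z ∈ Metric.ball (0 : E × ℂ) δ, z ∈ Z → ∀ w ∈ Metric.ball (0 : F) ε,
        G (z, w) = 0 := fun z hz hzZ w hw =>
      hG.apply_eq_zero_of_eventually (hεS (Metric.ball_subset_ball
        ((min_le_right _ _).trans (min_le_left _ _)) hz)) hzZ hw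
    have hPZ : ∀ᶠ z in 𝓝 (0 : E × ℂ), z ∈ Z → monicFn (a z.1) z.2 = 0 := by
      filter_upwards [hP, hev, hu.continuousAt.eventually_ne hu0] with z h1 h2 h3 hz
      rw [hZ z h2 hz w₁ hw₁] at h1
      exact (mul_eq_zero.1 h1.symm).resolve_left h3
    have hJ : J ≤ (vanishingIdeal Z).comap (germPoly E) := by
      refine Ideal.span_le.2 ?_
      rintro _ (rfl | ⟨⟨w, hw⟩, rfl⟩)
      · rw [SetLike.mem_coe, Ideal.mem_comap, germPoly_monicPoly, mkGerm_mem_vanishingIdeal]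
        exact hPZ
      · rw [SetLike.mem_coe, Ideal.mem_comap, germPoly_ofFn, mkGerm_mem_vanishingIdeal]
        filter_upwards [hPZ, hev] with z h1 h2 hz
        have h2' := mem_ball_prod_zero.1 h2
        have h3 := (hball z.1 h2'.1 w hw z.2 h2'.2).1
        rw [h1 hz, Prod.mk.eta,
          hZ z h2 hz w (Metric.ball_subset_ball ((min_le_right _ _).trans (min_le_right _ _)) hw)] at h3
        linear_combination -h3
    have h1 := hJ hρ
    rw [Ideal.mem_comap, germPoly, Polynomial.coe_eval₂RingHom, Polynomial.eval₂_C,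
      germPull_mkGerm, mkGerm_mem_vanishingIdeal] at h1
    exact h1
  · left
    obtain ⟨α, hα, hhα⟩ := exists_monicPoly_eq hmon
    have hα0 : α 0 = 0 := apply_zero_eq_zero_of_dvd haj hα ha0 (hhα ▸ hdvd P hPJ)
    have hgp : ∀ {c : E × ℂ → ℂ} (hc : AnalyticAt ℂ c 0), germPoly E h ∣ mkGerm c hc →
        ∃ q : E × ℂ → ℂ, AnalyticAt ℂ q 0 ∧ ∀ᶠ z in 𝓝 0, c z = monicFn (α z.1) z.2 * q z := by
      rintro c hc ⟨q, hq⟩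
      obtain ⟨q, hqa, rfl⟩ := exists_mkGerm q
      rw [hhα, germPoly_monicPoly, mkGerm_mul, mkGerm_eq] at hq
      exact ⟨q, hqa, hq⟩
    obtain ⟨p, hp, hPp⟩ := hgp (analyticAt_monicFn_fst haj)
      (germPoly_monicPoly haj ▸ map_dvd (germPoly E) (hdvd P hPJ))
    have hα00 : monicFn (α 0) 0 = 0 := by
      simp [monicFn, hα0, hdeg.ne']
    obtain ⟨G1, hG1, h1⟩ := exists_factor_of_dvd hG0 hα hα0 hδ fun w hw => by
      obtain ⟨q, hq, hRq⟩ := hgp (Finset.analyticAt_fun_sum _ fun j _ =>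
          analyticAt_sum_mul_pow (hrw w hw) j)
        (germPoly_ofFn (hrw w hw) ▸ map_dvd (germPoly E) (hdvd (R ⟨w, hw⟩) (hRJ _)))
      have hQw : AnalyticAt ℂ (fun z : E × ℂ => Q ((z.1, w), z.2)) 0 :=
        (hball 0 (Metric.mem_ball_self hδ) w hw 0 (Metric.mem_ball_self hδ)).2.1.comp_of_eq
          (f := fun z : E × ℂ => ((z.1, w), z.2)) (by fun_prop) rfl
      refine ⟨fun z => Q ((z.1, w), z.2) * p z + q z, (hQw.mul hp).add hq, ?_⟩
      filter_upwards [hPp, hRq, hev] with z h1 h2 h3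
      have h3' := mem_ball_prod_zero.1 h3
      have h4 := (hball z.1 h3'.1 w hw z.2 h3'.2).1
      rw [h1, h2, Prod.mk.eta] at h4
      rw [h4]
      ring
    exact ⟨fun z => monicFn (α z.1) z.2, G1, analyticAt_monicFn_fst hα, hG1, hα00, h1⟩

section Dimension

variable {E : Type*} [NormedAddCommGroup E] [NormedSpace ℂ E]

/-- The set of zeros in the fibres over `B` at which the fibre derivative does not vanish. -/
theorem dimH_simple_zeros_le [FiniteDimensional ℂ E] (f : E × ℂ → ℂ) (B : Set E) :
    dimH {y : E × ℂ | AnalyticAt ℂ f y ∧ y.1 ∈ B ∧ f y = 0 ∧ fderiv ℂ f y (0, 1) ≠ 0} ≤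
      dimH B := by
  have : ProperSpace (E × ℂ) := FiniteDimensional.proper ℂ _
  refine le_of_not_gt fun hlt => ?_
  obtain ⟨y, ⟨hy, -, -, hd⟩, h⟩ := exists_mem_nhdsWithin_lt_dimH_of_lt_dimH hlt
  have hc : 0 < ‖fderiv ℂ f y (0, 1)‖₊ / 2 := by simpa using hd
  obtain ⟨s, hs, hap⟩ := hy.hasStrictFDerivAt.approximates_deriv_on_nhds (Or.inr hc)
  set L := fderiv ℂ f y
  set T := {y : E × ℂ | AnalyticAt ℂ f y ∧ y.1 ∈ B ∧ f y = 0 ∧ fderiv ℂ f y (0, 1) ≠ 0}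
  refine (h (s ∩ T) (inter_mem (mem_nhdsWithin_of_mem_nhds hs) self_mem_nhdsWithin)).not_ge ?_
  set a := ‖L (0, 1)‖ with ha
  have ha0 : 0 < a := norm_pos_iff.2 hd
  have hK0 : 0 ≤ (‖L‖ + a / 2) / (a / 2) + 1 := by positivity
  have hanti : AntilipschitzWith ⟨(‖L‖ + a / 2) / (a / 2) + 1, hK0⟩
      (fun y : ↥(s ∩ T) => y.1.1) := by
    refine AntilipschitzWith.of_le_mul_dist fun u v => ?_
    have h1 := hap u.1 u.2.1 v.1 v.2.1
    rw [u.2.2.2.2.1, v.2.2.2.2.1] at h1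
    set d := u.1 - v.1 with hdef
    have hcoe : ((‖L (0, 1)‖₊ / 2 : NNReal) : ℝ) = a / 2 := by simp [ha]
    rw [sub_self, zero_sub, norm_neg, hcoe] at h1
    have h2 : d.2 • L (0, 1) = L d - L (d.1, 0) := by
      rw [← map_smul, ← map_sub]
      congr 1
      ext <;> simp
    have h3 : ‖d.2‖ * a ≤ ‖L d‖ + ‖L‖ * ‖d.1‖ := by
      rw [ha, ← norm_smul, h2]
      refine (norm_sub_le _ _).trans (add_le_add_right ?_ _)
      simpa using L.le_opNorm (d.1, 0)
    have h4 : ‖d‖ ≤ ‖d.1‖ + ‖d.2‖ :=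
      max_le (le_add_of_nonneg_right (norm_nonneg _)) (le_add_of_nonneg_left (norm_nonneg _))
    have h5 : ‖d.2‖ ≤ (‖L‖ + a / 2) / (a / 2) * ‖d.1‖ := by
      rw [div_mul_eq_mul_div, le_div_iff₀ (by positivity)]
      nlinarith
    rw [Subtype.dist_eq, dist_eq_norm, dist_eq_norm]
    change ‖d‖ ≤ ((‖L‖ + a / 2) / (a / 2) + 1) * ‖d.1‖
    linarith
  calc dimH (s ∩ T) = dimH (univ : Set ↥(s ∩ T)) := by
        rw [← isometry_subtype_coe.dimH_image univ, image_univ, Subtype.range_coe]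
    _ ≤ dimH ((fun y : ↥(s ∩ T) => y.1.1) '' univ) := hanti.le_dimH_image _
    _ ≤ dimH B := dimH_mono (by
        rintro - ⟨u, -, rfl⟩
        exact u.2.2.2.1)

theorem exists_iterate_of_not_eventually_zero {f : E × ℂ → ℂ} {y : E × ℂ} (hf : AnalyticAt ℂ f y)
    (h0 : f y = 0) (h : ¬ ∀ᶠ t in 𝓝 y.2, f (y.1, t) = 0) :
    ∃ k, AnalyticAt ℂ ((fun g y => fderiv ℂ g y (0, 1))^[k] f) y ∧
      (fun g y => fderiv ℂ g y (0, 1))^[k] f y = 0 ∧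
      fderiv ℂ ((fun g y => fderiv ℂ g y (0, 1))^[k] f) y (0, 1) ≠ 0 := by
  set D : (E × ℂ → ℂ) → E × ℂ → ℂ := fun g y => fderiv ℂ g y (0, 1) with hD
  have han : ∀ k z, AnalyticAt ℂ f z → AnalyticAt ℂ (D^[k] f) z := by
    intro k
    induction k with
    | zero => exact fun z hz => hz
    | succ k ih =>
      intro z hz
      rw [Function.iterate_succ_apply']
      exact ((ContinuousLinearMap.apply ℂ ℂ ((0 : E), (1 : ℂ))).analyticAt _).comp (ih z hz).fderiv
  have hit : ∀ k, ∀ᶠ t in 𝓝 y.2, iteratedDeriv k (fun t => f (y.1, t)) t = D^[k] f (y.1, t) := by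
    intro k
    induction k with
    | zero => simp
    | succ k ih =>
      have hA : ∀ᶠ t in 𝓝 y.2, AnalyticAt ℂ f (y.1, t) :=
        (Continuous.tendsto' (by fun_prop) y.2 y rfl).eventually hf.eventually_analyticAt
      filter_upwards [ih.eventually_nhds, hA] with t ht hAt
      rw [iteratedDeriv_succ, Function.iterate_succ_apply', EventuallyEq.deriv_eq ht]
      have h1 : HasDerivAt (fun t : ℂ => (y.1, t)) ((0 : E), (1 : ℂ)) t :=
        (hasDerivAt_const t y.1).prodMk (hasDerivAt_id t)
      exact ((han k _ hAt).differentiableAt.hasFDerivAt.comp_hasDerivAt t h1).deriv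
  have hex : ∃ k, D^[k] f y ≠ 0 := by
    by_contra! hall
    refine h (analyticOrderAt_eq_top.1 (ENat.eq_top_iff_forall_ge.2 fun n => ?_))
    have hsl : AnalyticAt ℂ (fun t => f (y.1, t)) y.2 :=
      hf.comp_of_eq (f := fun t => (y.1, t)) (by fun_prop) rfl
    rw [natCast_le_analyticOrderAt_iff_iteratedDeriv_eq_zero hsl]
    exact fun i _ => (hit i).self_of_nhds.trans (hall i)
  obtain ⟨k, hk⟩ : ∃ k, Nat.find hex = k + 1 :=
    Nat.exists_eq_succ_of_ne_zero fun h => Nat.find_spec hex (by rw [h]; exact h0)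
  refine ⟨k, han k y hf, not_not.1 (Nat.find_min hex (hk ▸ k.lt_succ_self)), ?_⟩
  have h1 := Nat.find_spec hex
  rwa [hk, Function.iterate_succ_apply'] at h1

theorem dimH_zeros_le [FiniteDimensional ℂ E] (f : E × ℂ → ℂ) (B : Set E) :
    dimH {y : E × ℂ | AnalyticAt ℂ f y ∧ y.1 ∈ B ∧ f y = 0 ∧
      ¬ ∀ᶠ t in 𝓝 y.2, f (y.1, t) = 0} ≤ dimH B := by
  refine (dimH_mono (t := ⋃ k : ℕ, {y : E × ℂ | AnalyticAt ℂ
    ((fun g y => fderiv ℂ g y (0, 1))^[k] f) y ∧ y.1 ∈ B ∧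
    (fun g y => fderiv ℂ g y (0, 1))^[k] f y = 0 ∧
    fderiv ℂ ((fun g y => fderiv ℂ g y (0, 1))^[k] f) y (0, 1) ≠ 0}) ?_).trans ?_
  · rintro y ⟨hf, hB, h0, h⟩
    obtain ⟨k, h1, h2, h3⟩ := exists_iterate_of_not_eventually_zero hf h0 h
    exact mem_iUnion.2 ⟨k, h1, hB, h2, h3⟩
  · rw [dimH_iUnion]
    exact iSup_le fun k => dimH_simple_zeros_le _ B

theorem exists_ball_dimH_zeros_le [FiniteDimensional ℂ E] {f : E × ℂ → ℂ} (hf : AnalyticAt ℂ f 0)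
    (h : ¬ ∀ᶠ t in 𝓝 (0 : ℂ), f (0, t) = 0) :
    ∃ δ > 0, ∀ B : Set E, dimH {y ∈ Metric.ball (0 : E × ℂ) δ | y.1 ∈ B ∧ f y = 0} ≤ dimH B := by
  obtain ⟨ε, hε, hball⟩ := hf.exists_ball
  obtain ⟨t, ht, ht0⟩ : ∃ t ∈ Metric.ball (0 : ℂ) ε, f (0, t) ≠ 0 := by
    by_contra! hall
    exact h (Metric.eventually_nhds_iff_ball.2 ⟨ε, hε, hall⟩)
  have h1 : ∀ᶠ x in 𝓝 (0 : E), f (x, t) ≠ 0 :=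
    ((hball (0, t) (mem_ball_prod_zero.2 ⟨Metric.mem_ball_self hε, ht⟩)).comp_of_eq
      (f := fun x => (x, t)) (by fun_prop) rfl).continuousAt.eventually_ne ht0
  obtain ⟨δ, hδ, hδball⟩ := Metric.eventually_nhds_iff_ball.1 h1
  refine ⟨min ε δ, lt_min hε hδ, fun B => le_trans (dimH_mono ?_) (dimH_zeros_le f B)⟩
  rintro y ⟨hy, hyB, hy0⟩
  have hyε := Metric.ball_subset_ball (min_le_left _ _) hy
  have hyδ := Metric.ball_subset_ball (min_le_right _ _) hy
  refine ⟨hball y hyε, hyB, hy0, fun hev => hδball y.1 (mem_ball_prod_zero.1 hyδ).1 ?_⟩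
  have hsl : AnalyticOnNhd ℂ (fun t => f (y.1, t)) (Metric.ball (0 : ℂ) ε) := fun t ht =>
    (hball (y.1, t) (mem_ball_prod_zero.2 ⟨(mem_ball_prod_zero.1 hyε).1, ht⟩)).comp_of_eq
      (f := fun t => (y.1, t)) (by fun_prop) rfl
  exact hsl.eqOn_zero_ball (mem_ball_prod_zero.1 hyε).2 hev t ht

theorem dimH_univ_fin_complex (n : ℕ) : dimH (univ : Set (Fin n → ℂ)) = ((2 * n : ℕ) : ℝ≥0∞) := by
  rw [Real.dimH_univ_eq_finrank, Module.finrank_pi_fintype]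
  simp [Complex.finrank_real_complex, mul_comm]

theorem exists_ball_dimH_zeros_le_finrank [FiniteDimensional ℂ E] {f : E → ℂ}
    (hf : AnalyticAt ℂ f 0) (h : ¬ ∀ᶠ x in 𝓝 0, f x = 0) :
    ∃ δ > 0, dimH {x ∈ Metric.ball (0 : E) δ | f x = 0} ≤
      ((2 * Module.finrank ℂ E - 2 : ℕ) : ℝ≥0∞) := by
  by_cases h0 : f 0 = 0
  · obtain ⟨v, hv⟩ := hf.exists_line h
    have hv0 : v ≠ 0 := by
      rintro rfl
      simp [h0] at hv
    obtain ⟨n, e, hn, he⟩ := exists_equiv_prod hv0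
    obtain ⟨δ, hδ, hdim⟩ := exists_ball_dimH_zeros_le (f := fun y => f (e y))
      (hf.comp_of_eq (f := e) (e.toContinuousLinearMap.analyticAt 0) (map_zero e))
      (by simpa [he] using hv)
    have hmem : e '' Metric.ball 0 δ ∈ 𝓝 (0 : E) := by
      rw [← map_zero e]
      exact e.toHomeomorph.isOpenMap.image_mem_nhds (Metric.ball_mem_nhds _ hδ)
    obtain ⟨δ', hδ', hsub⟩ := Metric.mem_nhds_iff.1 hmem
    refine ⟨δ', hδ', ?_⟩
    rw [hn, show 2 * (n + 1) - 2 = 2 * n by omega, ← dimH_univ_fin_complex]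
    refine le_trans ?_ (hdim univ)
    rw [← e.dimH_image]
    refine dimH_mono ?_
    rintro x ⟨hx, hx0⟩
    obtain ⟨y, hy, rfl⟩ := hsub hx
    exact ⟨y, ⟨hy, mem_univ _, hx0⟩, rfl⟩
  · obtain ⟨δ, hδ, hball⟩ := Metric.eventually_nhds_iff_ball.1 (hf.continuousAt.eventually_ne h0)
    refine ⟨δ, hδ, ?_⟩
    rw [show {x ∈ Metric.ball (0 : E) δ | f x = 0} = ∅ from
      eq_empty_of_forall_notMem fun x hx => hball x hx.1 hx.2, dimH_empty]
    exact bot_le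

end Dimension

section FactorOrDegenerate

variable {E F : Type*} [NormedAddCommGroup E] [NormedSpace ℂ E]
  [NormedAddCommGroup F] [NormedSpace ℂ F]

/-- Near the origin, the points over which `G` vanishes identically lie in an analytic set of
codimension at least two, cut out by two functions. -/
def DegenerateInCodimTwo (G : E × F → ℂ) : Prop :=
  ∃ δ > 0, ∃ a ρ : E → ℂ, AnalyticOnNhd ℂ a (Metric.ball 0 δ) ∧
    AnalyticOnNhd ℂ ρ (Metric.ball 0 δ) ∧
    dimH {x ∈ Metric.ball (0 : E) δ | a x = 0 ∧ ρ x = 0} ≤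
      ((2 * Module.finrank ℂ E - 4 : ℕ) : ℝ≥0∞) ∧
    ∀ x ∈ Metric.ball (0 : E) δ, (∀ᶠ w in 𝓝 0, G (x, w) = 0) → a x = 0 ∧ ρ x = 0

/-- Unless a factor vanishing at the origin and depending on the first variable only splits off
from `G`, the points over which `G` vanishes identically form a set of codimension two. -/
theorem exists_factor_or_degenerateInCodimTwo [FiniteDimensional ℂ E] [FiniteDimensional ℂ F]
    {G : E × F → ℂ} (hG : AnalyticAt ℂ G 0) (h0 : ¬ ∀ᶠ y in 𝓝 0, G y = 0) :
    (∃ (h : E → ℂ) (G₁ : E × F → ℂ), AnalyticAt ℂ h 0 ∧ AnalyticAt ℂ G₁ 0 ∧ h 0 = 0 ∧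
      ∀ᶠ y in 𝓝 0, G y = h y.1 * G₁ y) ∨ DegenerateInCodimTwo G := by
  obtain ⟨ε, hε, hball⟩ := hG.exists_ball
  have hGε : AnalyticOnNhd ℂ G (Metric.ball 0 ε ×ˢ Metric.ball 0 ε) := fun y hy =>
    hball y (mem_ball_prod_zero.2 hy)
  have hsl : ∀ w ∈ Metric.ball (0 : F) ε,
      AnalyticOnNhd ℂ (fun x => G (x, w)) (Metric.ball 0 ε) := fun w hw x hx =>
    (hGε (x, w) ⟨hx, hw⟩).comp_of_eq (f := fun x => (x, w)) (by fun_prop) rfl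
  obtain ⟨w₁, hw₁, hGw⟩ : ∃ w₁ ∈ Metric.ball (0 : F) ε, ¬ ∀ᶠ x in 𝓝 0, G (x, w₁) = 0 := by
    by_contra! hall
    refine h0 (Metric.eventually_nhds_iff_ball.2 ⟨ε, hε, fun y hy => ?_⟩)
    have hy' := mem_ball_prod_zero.1 hy
    exact (hsl y.2 hy'.2).eqOn_zero_ball (Metric.mem_ball_self hε) (hall y.2 hy'.2) y.1 hy'.1
  have hvan : ∀ x ∈ Metric.ball (0 : E) ε, (∀ᶠ w in 𝓝 0, G (x, w) = 0) → G (x, w₁) = 0 :=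
    fun x hx h => hGε.apply_eq_zero_of_eventually hx h hw₁
  have hb := hsl w₁ hw₁
  by_cases hb0 : G (0, w₁) = 0
  swap
  · right
    obtain ⟨δ, hδ, hδb⟩ := Metric.eventually_nhds_iff_ball.1
      ((hb 0 (Metric.mem_ball_self hε)).continuousAt.eventually_ne hb0)
    have hsub : Metric.ball (0 : E) (min ε δ) ⊆ Metric.ball 0 ε :=
      Metric.ball_subset_ball (min_le_left _ _)
    refine ⟨min ε δ, lt_min hε hδ, _, _, hb.mono hsub, hb.mono hsub, ?_, fun x hx h =>
      ⟨hvan x (hsub hx) h, hvan x (hsub hx) h⟩⟩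
    rw [show {x ∈ Metric.ball (0 : E) (min ε δ) | G (x, w₁) = 0 ∧ G (x, w₁) = 0} = ∅ from
      eq_empty_of_forall_notMem fun x hx =>
        hδb x (Metric.ball_subset_ball (min_le_right _ _) hx.1) hx.2.1, dimH_empty]
    exact bot_le
  obtain ⟨v, hv⟩ := (hb 0 (Metric.mem_ball_self hε)).exists_line hGw
  have hv0 : v ≠ 0 := by
    rintro rfl
    simp [hb0] at hv
  obtain ⟨n, e, hn, he⟩ := exists_equiv_prod hv0
  have hea : ∀ z, AnalyticAt ℂ e z := fun z => e.toContinuousLinearMap.analyticAt z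
  have hesa : ∀ x, AnalyticAt ℂ e.symm x := fun x => e.symm.toContinuousLinearMap.analyticAt x
  have hes : Tendsto e.symm (𝓝 0) (𝓝 0) := e.symm.continuous.tendsto' 0 0 (map_zero _)
  have hGe : AnalyticOnNhd ℂ (fun y : ((Fin n → ℂ) × ℂ) × F => G (e y.1, y.2))
      ((e ⁻¹' Metric.ball 0 ε) ×ˢ Metric.ball 0 ε) := fun y hy =>
    (hGε (e y.1, y.2) hy).comp_of_eq (f := fun y : ((Fin n → ℂ) × ℂ) × F => (e y.1, y.2))
      (((hea y.1).comp_of_eq analyticAt_fst rfl).prod analyticAt_snd) rfl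
  have hS : e ⁻¹' Metric.ball 0 ε ∈ 𝓝 0 :=
    e.continuous.continuousAt.preimage_mem_nhds (by
      rw [map_zero]
      exact Metric.ball_mem_nhds _ hε)
  rcases exists_factor_or_degenerate_subset_aux hS hGe hw₁ (by simpa [he] using hv) with
    ⟨h, G₁, hh, hG₁, hh0, hfac⟩ | ⟨ρ, hρ, hρ0, hdeg⟩
  · left
    have hes2 : AnalyticAt ℂ (fun y : E × F => (e.symm y.1, y.2)) 0 :=
      ((hesa 0).comp_of_eq analyticAt_fst rfl).prod analyticAt_snd
    have hes2' : Tendsto (fun y : E × F => (e.symm y.1, y.2)) (𝓝 0) (𝓝 0) := by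
      refine Continuous.tendsto' (by fun_prop) _ _ (by simp)
    refine ⟨fun x => h (e.symm x), fun y => G₁ (e.symm y.1, y.2),
      hh.comp_of_eq (hesa 0) (map_zero _), hG₁.comp_of_eq hes2 (by simp), by simpa using hh0, ?_⟩
    filter_upwards [hes2'.eventually hfac] with y hy
    simpa using hy
  · right
    obtain ⟨δ₁, hδ₁, hdim₁⟩ := exists_ball_dimH_zeros_le (f := fun z => G (e z, w₁))
      ((hb 0 (Metric.mem_ball_self hε)).comp_of_eq (hea 0) (map_zero e))
      (by simpa [he] using hv)
    obtain ⟨δ₂, hδ₂, hdim₂⟩ := exists_ball_dimH_zeros_le_finrank hρ hρ0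
    have hρe : AnalyticAt ℂ (fun x => ρ (e.symm x).1) 0 :=
      hρ.comp_of_eq (f := fun x => (e.symm x).1)
        (analyticAt_fst.comp_of_eq (hesa 0) rfl) (by simp)
    have hev : ∀ {r : ℝ}, 0 < r →
        ∀ᶠ z in 𝓝 (0 : (Fin n → ℂ) × ℂ), z ∈ Metric.ball (0 : (Fin n → ℂ) × ℂ) r :=
      fun hr => Metric.ball_mem_nhds _ hr
    obtain ⟨δ, hδ, hδball⟩ := Metric.eventually_nhds_iff_ball.1
      ((hρe.eventually_analyticAt.and (Metric.ball_mem_nhds (0 : E) hε)).and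
        (hes.eventually (hdeg.and ((hev hδ₁).and (hev hδ₂)))))
    refine ⟨δ, hδ, fun x => G (x, w₁), fun x => ρ (e.symm x).1, fun x hx => hb x
      (hδball x hx).1.2, fun x hx => (hδball x hx).1.1, ?_, fun x hx h =>
      ⟨hvan x (hδball x hx).1.2 h, (hδball x hx).2.1 (by simpa using h)⟩⟩
    rw [Module.finrank_fin_fun] at hdim₂
    rw [hn, show 2 * (n + 1) - 4 = 2 * n - 2 by omega]
    refine le_trans ?_ ((hdim₁ _).trans hdim₂)
    rw [← e.symm.dimH_image]
    refine dimH_mono ?_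
    rintro - ⟨x, ⟨hx, hx1, hx2⟩, rfl⟩
    obtain ⟨-, -, h1, h2⟩ := hδball x hx
    exact ⟨h1, ⟨(mem_ball_prod_zero.1 h2).1, hx2⟩, by simpa using hx1⟩

end FactorOrDegenerate

section MaximalFactorization

variable {E F : Type*} [NormedAddCommGroup E] [NormedSpace ℂ E]
  [NormedAddCommGroup F] [NormedSpace ℂ F]

theorem analyticOrderAt_lt_of_eq_mul {h G₁ G : E → ℂ} (hh : AnalyticAt ℂ h 0)
    (hG₁ : AnalyticAt ℂ G₁ 0) (hh0 : h 0 = 0) (hG : ∀ᶠ y in 𝓝 0, G y = h y * G₁ y) {v : E}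
    (hv : analyticOrderAt (fun t : ℂ => G (t • v)) 0 ≠ ⊤) :
    analyticOrderAt (fun t : ℂ => G₁ (t • v)) 0 < analyticOrderAt (fun t : ℂ => G (t • v)) 0 := by
  have hc : Tendsto (fun t : ℂ => t • v) (𝓝 0) (𝓝 0) :=
    Continuous.tendsto' (by fun_prop) _ _ (by simp)
  have hsl : ∀ {f : E → ℂ}, AnalyticAt ℂ f 0 → AnalyticAt ℂ (fun t : ℂ => f (t • v)) 0 :=
    fun hf => hf.comp_of_eq (f := fun t : ℂ => t • v) (by fun_prop) (by simp)
  have h1 : analyticOrderAt (fun t : ℂ => G (t • v)) 0 =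
      analyticOrderAt (fun t : ℂ => h (t • v)) 0 + analyticOrderAt (fun t : ℂ => G₁ (t • v)) 0 := by
    rw [← analyticOrderAt_mul (hsl hh) (hsl hG₁)]
    exact analyticOrderAt_congr (hc.eventually hG)
  have h2 : analyticOrderAt (fun t : ℂ => h (t • v)) 0 ≠ 0 :=
    (hsl hh).analyticOrderAt_ne_zero.2 (by simpa using hh0)
  rw [h1] at hv ⊢
  have h3 := (WithTop.add_ne_top.1 hv).2
  conv_lhs => rw [← zero_add (analyticOrderAt (fun t : ℂ => G₁ (t • v)) 0)]
  exact (ENat.add_lt_add_iff_right h3).2 (pos_iff_ne_zero.2 h2)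

/-- Splitting off all factors that depend on one of the two variables only. -/
theorem exists_factorization_degenerateInCodimTwo [FiniteDimensional ℂ E]
    [FiniteDimensional ℂ F] {G : E × F → ℂ} (hG : AnalyticAt ℂ G 0)
    (h0 : ¬ ∀ᶠ y in 𝓝 0, G y = 0) :
    ∃ (h : E → ℂ) (k : F → ℂ) (G₁ : E × F → ℂ), AnalyticAt ℂ h 0 ∧ AnalyticAt ℂ k 0 ∧
      AnalyticAt ℂ G₁ 0 ∧ (∀ᶠ y in 𝓝 0, G y = h y.1 * k y.2 * G₁ y) ∧
      DegenerateInCodimTwo G₁ ∧ DegenerateInCodimTwo (fun y : F × E => G₁ y.swap) := by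
  obtain ⟨v, hv⟩ := hG.exists_line h0
  simp only [zero_add] at hv
  have hne : ∀ {g : E × F → ℂ} {n : ℕ}, analyticOrderAt (fun t : ℂ => g (t • v)) 0 = n →
      ¬ ∀ᶠ y in 𝓝 0, g y = 0 := fun {g n} hg hev => by
    have hc : Tendsto (fun t : ℂ => t • v) (𝓝 0) (𝓝 0) :=
      Continuous.tendsto' (by fun_prop) _ _ (by simp)
    have := analyticOrderAt_eq_top.2 (hc.eventually hev)
    simp [hg] at this
  obtain ⟨n, hn⟩ := ENat.ne_top_iff_exists.1 (mt analyticOrderAt_eq_top.1 hv)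
  clear hv h0
  induction n using Nat.strong_induction_on generalizing G with
  | _ n ih =>
    have hlt : ∀ {h G₁ : E × F → ℂ}, AnalyticAt ℂ h 0 → AnalyticAt ℂ G₁ 0 → h 0 = 0 →
        (∀ᶠ y in 𝓝 0, G y = h y * G₁ y) →
        ∃ m < n, (m : ℕ∞) = analyticOrderAt (fun t : ℂ => G₁ (t • v)) 0 := by
      intro h G₁ hh hG₁ hh0 hev
      have h1 := analyticOrderAt_lt_of_eq_mul (v := v) hh hG₁ hh0 hev (by simp [← hn])
      obtain ⟨m, hm⟩ := ENat.ne_top_iff_exists.1 h1.ne_top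
      rw [← hm, ← hn] at h1
      exact ⟨m, by exact_mod_cast h1, hm⟩
    rcases exists_factor_or_degenerateInCodimTwo hG (hne hn.symm) with
      ⟨h, G₁, hh, hG₁, hh0, hfac⟩ | hdeg
    · have hh' : AnalyticAt ℂ (fun y : E × F => h y.1) 0 := hh.comp_of_eq analyticAt_fst rfl
      obtain ⟨m, hm, hmo⟩ := hlt hh' hG₁ hh0 hfac
      obtain ⟨h', k, G₂, hh', hk, hG₂, hev, hd⟩ := ih m hm hG₁ hmo
      refine ⟨fun x => h x * h' x, k, G₂, hh.mul hh', hk, hG₂, ?_, hd⟩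
      filter_upwards [hfac, hev] with y h1 h2
      rw [h1, h2]
      ring
    have hsw : AnalyticAt ℂ (fun y : F × E => G y.swap) 0 :=
      hG.comp_of_eq (analyticAt_snd.prod analyticAt_fst) rfl
    have hswt : Tendsto (Prod.swap : E × F → F × E) (𝓝 0) (𝓝 0) :=
      continuous_swap.tendsto' _ _ rfl
    have hswt' : Tendsto (Prod.swap : F × E → E × F) (𝓝 0) (𝓝 0) :=
      continuous_swap.tendsto' _ _ rfl
    rcases exists_factor_or_degenerateInCodimTwo hsw
      (fun hev => hne hn.symm ((hswt.eventually hev).mono fun y hy => by simpa using hy)) with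
      ⟨k, G₁, hk, hG₁, hk0, hfac⟩ | hdeg'
    · have hk' : AnalyticAt ℂ (fun y : E × F => k y.2) 0 := hk.comp_of_eq analyticAt_snd rfl
      have hG₁' : AnalyticAt ℂ (fun y : E × F => G₁ y.swap) 0 :=
        hG₁.comp_of_eq (analyticAt_snd.prod analyticAt_fst) rfl
      have hfac' : ∀ᶠ y in 𝓝 (0 : E × F), G y = k y.2 * G₁ y.swap :=
        (hswt.eventually hfac).mono fun y hy => by simpa using hy
      obtain ⟨m, hm, hmo⟩ := hlt hk' hG₁' hk0 hfac'
      obtain ⟨h, k', G₂, hh, hk', hG₂, hev, hd⟩ := ih m hm hG₁' hmo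
      refine ⟨h, fun x => k x * k' x, G₂, hh, hk.mul hk', hG₂, ?_, hd⟩
      filter_upwards [hfac', hev] with y h1 h2
      rw [h1, h2]
      ring
    exact ⟨fun _ => 1, fun _ => 1, G, analyticAt_const, analyticAt_const, hG, by simp, hdeg, hdeg'⟩

end MaximalFactorization

section Complexification

theorem AnalyticAt.star_star {E : Type*} [NormedAddCommGroup E] [NormedSpace ℂ E]
    [FiniteDimensional ℂ E] [StarAddMonoid E] [ContinuousStar E] [StarModule ℂ E] {f : E → ℂ}
    {z : E} (hf : AnalyticAt ℂ f (star z)) : AnalyticAt ℂ (fun x => star (f (star x))) z := by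
  obtain ⟨ε, hε, hball⟩ := hf.exists_ball
  have hopen : IsOpen (star ⁻¹' Metric.ball (star z) ε) :=
    Metric.isOpen_ball.preimage continuous_star
  refine analyticOnNhd_of_differentiableOn hopen (fun x hx => ?_) z (by simpa using hε)
  have h1 := (hball (star x) hx).differentiableAt.star_star
  rw [_root_.star_star] at h1
  exact h1.differentiableWithinAt

/-- The homogeneous part of degree `n` of the complexification of a power series. -/
def complexifyTerm {E ι : Type*} [NormedAddCommGroup E] [NormedSpace ℝ E] [Fintype ι] (e : ι → E)
    (p : FormalMultilinearSeries ℝ E ℝ) (n : ℕ) (ζ : ι → ℂ) : ℂ :=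
  ∑ i : Fin n → ι, (p n fun j => e (i j) : ℂ) * ∏ j, ζ (i j)

theorem norm_complexifyTerm_le {E ι : Type*} [NormedAddCommGroup E] [NormedSpace ℝ E] [Fintype ι]
    (e : ι → E) (p : FormalMultilinearSeries ℝ E ℝ) (n : ℕ) (ζ : ι → ℂ) :
    ‖complexifyTerm e p n ζ‖ ≤ ‖p n‖ * (∑ i, ‖e i‖ * ‖ζ i‖) ^ n := by
  rw [Fintype.sum_pow, Finset.mul_sum]
  refine (norm_sum_le _ _).trans (Finset.sum_le_sum fun i _ => ?_)
  rw [norm_mul, norm_prod, Complex.norm_real, Finset.prod_mul_distrib, ← mul_assoc]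
  exact mul_le_mul_of_nonneg_right ((p n).le_opNorm _) (by positivity)

open Classical in
theorem complexifyTerm_ofReal {E ι : Type*} [NormedAddCommGroup E] [NormedSpace ℝ E] [Fintype ι]
    (e : ι → E) (p : FormalMultilinearSeries ℝ E ℝ) (n : ℕ) (c : ι → ℝ) :
    complexifyTerm e p n (fun i => c i) = (p n fun _ => ∑ i, c i • e i : ℝ) := by
  rw [(p n).map_sum, complexifyTerm, Complex.ofReal_sum]
  refine Finset.sum_congr rfl fun i _ => ?_
  rw [(p n).map_smul_univ (fun j => c (i j)) fun j => e (i j)]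
  simp [mul_comm]

theorem AnalyticAt.exists_complexification {E ι : Type*} [NormedAddCommGroup E] [NormedSpace ℝ E]
    [Fintype ι] (e : ι → E) {f : E → ℝ} {x : E} (hf : AnalyticAt ℝ f x) :
    ∃ R : (ι → ℂ) → ℂ, AnalyticAt ℂ R 0 ∧
      ∀ᶠ c in 𝓝 (0 : ι → ℝ), R (fun i => c i) = f (x + ∑ i, c i • e i) := by
  obtain ⟨p, ρ, hp⟩ := hf
  obtain ⟨C, r, hC, hr, hbound⟩ := p.le_mul_pow_of_radius_pos (hp.r_pos.trans_le hp.r_le)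
  let U : Set (ι → ℂ) := {ζ | r * ∑ i, ‖e i‖ * ‖ζ i‖ < 1 / 2}
  have hU : IsOpen U := isOpen_lt (by fun_prop) continuous_const
  have hle : ∀ n, ∀ ζ ∈ U, ‖complexifyTerm e p n ζ‖ ≤ C * (1 / 2) ^ n := by
    intro n ζ hζ
    refine (norm_complexifyTerm_le e p n ζ).trans ?_
    calc ‖p n‖ * (∑ i, ‖e i‖ * ‖ζ i‖) ^ n ≤ C * r ^ n * (∑ i, ‖e i‖ * ‖ζ i‖) ^ n := by
          gcongr
          exact hbound n
      _ = C * (r * ∑ i, ‖e i‖ * ‖ζ i‖) ^ n := by rw [mul_pow, mul_assoc]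
      _ ≤ C * (1 / 2) ^ n := by
          gcongr
          exact le_of_lt hζ
  have hsum : Summable fun n : ℕ => C * (1 / 2 : ℝ) ^ n := summable_geometric_two.mul_left C
  have hd : ∀ n, Differentiable ℂ (complexifyTerm e p n) := fun n => by
    unfold complexifyTerm
    fun_prop
  refine ⟨fun ζ => ∑' n, complexifyTerm e p n ζ, osgood _ ℂ _ U hU
    (continuousOn_tsum (fun n => (hd n).continuous.continuousOn) hsum hle) ?_ 0 ?_, ?_⟩
  · intro ζ hζ v
    have hc : Continuous fun t : ℂ => ζ + t • v := by fun_prop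
    have hV : IsOpen ((fun t : ℂ => ζ + t • v) ⁻¹' U) := hU.preimage hc
    refine (differentiableOn_tsum_of_summable_norm hsum (fun n => ?_) hV
      fun n t ht => hle n _ ht).differentiableAt (hV.mem_nhds (by simpa using hζ))
    exact ((hd n).comp (by fun_prop : Differentiable ℂ fun t : ℂ => ζ + t • v)).differentiableOn
  · simp [U]
  · have ht : Tendsto (fun c : ι → ℝ => ∑ i, c i • e i) (𝓝 0) (𝓝 0) :=
      Continuous.tendsto' (by fun_prop) _ _ (by simp)
    filter_upwards [ht.eventually (Metric.eball_mem_nhds 0 hp.r_pos)] with c hc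
    simp_rw [complexifyTerm_ofReal]
    exact (Complex.hasSum_ofReal.2 (hp.hasSum hc)).tsum_eq

/-- Near `(x, x̄)`, a real-analytic function extends to a holomorphic function of `z` and `z̄`. -/
theorem AnalyticAt.exists_polarization {N : ℕ} {f : (Fin N → ℂ) → ℝ} {x : Fin N → ℂ}
    (hf : AnalyticAt ℝ f x) :
    ∃ R : (Fin N → ℂ) × (Fin N → ℂ) → ℂ, AnalyticAt ℂ R 0 ∧
      ∀ᶠ z in 𝓝 (0 : Fin N → ℂ), R (z, star z) = f (x + z) := by
  obtain ⟨R, hR, hRf⟩ := hf.exists_complexification (ι := Fin N ⊕ Fin N)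
    (Sum.elim (fun j => Pi.single j 1) fun j => Pi.single j I)
  let T : (Fin N → ℂ) × (Fin N → ℂ) → Fin N ⊕ Fin N → ℂ := fun y =>
    Sum.elim (fun j => (y.1 j + y.2 j) * 2⁻¹) fun j => (y.1 j - y.2 j) * (2 * I)⁻¹
  have hT : AnalyticAt ℂ T 0 := by
    have hfst := analyticAt_pi_iff.1
      (analyticAt_fst (𝕜 := ℂ) (p := (0 : (Fin N → ℂ) × (Fin N → ℂ))))
    have hsnd := analyticAt_pi_iff.1
      (analyticAt_snd (𝕜 := ℂ) (p := (0 : (Fin N → ℂ) × (Fin N → ℂ))))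
    refine analyticAt_pi_iff.2 ?_
    rintro (j | j)
    · exact ((hfst j).add (hsnd j)).mul (analyticAt_const (v := (2 : ℂ)⁻¹))
    · exact ((hfst j).sub (hsnd j)).mul (analyticAt_const (v := (2 * I)⁻¹))
  refine ⟨fun y => R (T y), hR.comp_of_eq hT ?_, ?_⟩
  · ext (j | j) <;> simp [T]
  let c : (Fin N → ℂ) → Fin N ⊕ Fin N → ℝ := fun z =>
    Sum.elim (fun j => (z j).re) fun j => (z j).im
  have hc : Tendsto c (𝓝 0) (𝓝 0) := by
    refine Continuous.tendsto' (continuous_pi ?_) _ _ ?_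
    · rintro (j | j) <;> simp only [c, Sum.elim_inl, Sum.elim_inr] <;> fun_prop
    · ext (j | j) <;> simp [c]
  filter_upwards [hc.eventually hRf] with z hz
  have h1 : T (z, star z) = fun i => (c z i : ℂ) := by
    ext (j | j)
    · simp only [T, c, Sum.elim_inl, Pi.star_apply, RCLike.star_def, Complex.add_conj]
      push_cast
      ring
    · simp only [T, c, Sum.elim_inr, Pi.star_apply, RCLike.star_def, Complex.sub_conj]
      push_cast
      field_simp
  have h2 : ∑ i, c z i • Sum.elim (fun j => Pi.single j (1 : ℂ)) (fun j => Pi.single j I) i = z := by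
    ext j
    simp [c, Fintype.sum_sum_type, Pi.single_apply, Complex.re_add_im]
  rw [h1, hz, h2]

end Complexification

section RealDefiningFunction

variable {E : Type*} [NormedAddCommGroup E] [StarAddMonoid E]

/-- A function of `z` and `w` whose values for `w = z̄` are `|h|² + (Re h)²` at `z`; unlike the
complexification of `|h|²`, it vanishes for all `z` and fixed `w` only if `h` vanishes. -/
def realifyMul (h : E → ℂ) (y : E × E) : ℂ :=
  h y.1 * star (h (star y.2)) + ((h y.1 + star (h (star y.2))) / 2) ^ 2

theorem realifyMul_star (h : E → ℂ) (z : E) :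
    realifyMul h (z, star z) = (normSq (h z) + (h z).re ^ 2 : ℝ) := by
  rw [realifyMul, _root_.star_star, RCLike.star_def, Complex.mul_conj, Complex.add_conj]
  push_cast
  ring

theorem realifyMul_star_eq_zero {h : E → ℂ} {z : E} :
    realifyMul h (z, star z) = 0 ↔ h z = 0 := by
  rw [realifyMul_star, Complex.ofReal_eq_zero]
  refine ⟨fun h0 => normSq_eq_zero.1 ?_, fun h0 => by simp [h0]⟩
  nlinarith [normSq_nonneg (h z), sq_nonneg (h z).re]

theorem eventually_eq_zero_of_realifyMul {h : E → ℂ} {q : E}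
    (hq : ∀ᶠ z in 𝓝 q, realifyMul h (z, star q) = 0) : ∀ᶠ z in 𝓝 q, h z = 0 := by
  have h0 := realifyMul_star_eq_zero.1 hq.self_of_nhds
  filter_upwards [hq] with z hz
  simpa [realifyMul, _root_.star_star, h0] using hz

theorem analyticAt_realifyMul [NormedSpace ℂ E] [FiniteDimensional ℂ E] [NormedStarGroup E]
    [StarModule ℂ E]
    {h : E → ℂ} {y : E × E} (h1 : AnalyticAt ℂ h y.1) (h2 : AnalyticAt ℂ h (star y.2)) :
    AnalyticAt ℂ (realifyMul h) y := by
  have h3 : AnalyticAt ℂ (fun y : E × E => h y.1) y := h1.comp_of_eq analyticAt_fst rfl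
  have h4 : AnalyticAt ℂ (fun y : E × E => star (h (star y.2))) y :=
    (AnalyticAt.star_star h2).comp_of_eq (g := fun x => star (h (star x))) analyticAt_snd rfl
  exact (h3.mul h4).add (((h3.add h4).mul (analyticAt_const (v := (2 : ℂ)⁻¹))).pow 2)

theorem star_mem_ball_zero [NormedStarGroup E] {δ : ℝ} {z : E} :
    star z ∈ Metric.ball (0 : E) δ ↔ z ∈ Metric.ball (0 : E) δ := by
  simp

/-- A holomorphic function of `z` and `z̄` can be replaced by one that is real for `w = z̄`, has
the same zeros there, and is degenerate only in codimension two. -/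
theorem exists_realification [NormedSpace ℂ E] [FiniteDimensional ℂ E] [NormedStarGroup E]
    [StarModule ℂ E]
    {R : E × E → ℂ} (hR : AnalyticAt ℂ R 0) (hR0 : ¬ ∀ᶠ y in 𝓝 0, R y = 0) :
    ∃ δ > 0, ∃ (S : E × E → ℂ) (f : Fin 4 → E → ℂ),
      AnalyticOnNhd ℂ S (Metric.ball 0 δ ×ˢ Metric.ball 0 δ) ∧
      (∀ i, AnalyticOnNhd ℂ (f i) (Metric.ball 0 δ)) ∧
      (∀ z ∈ Metric.ball (0 : E) δ, (S (z, star z)).im = 0 ∧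
        (S (z, star z) = 0 ↔ R (z, star z) = 0)) ∧
      dimH {x ∈ Metric.ball (0 : E) δ | ∀ i, f i x = 0} ≤
        ((2 * Module.finrank ℂ E - 4 : ℕ) : ℝ≥0∞) ∧
      ∀ q ∈ Metric.ball (0 : E) δ, (∀ᶠ z in 𝓝 q, S (z, star q) = 0) → ∀ i, f i q = 0 := by
  obtain ⟨h, k, G, hh, hk, hG, hfac, ⟨δ₁, hδ₁, a₁, ρ₁, ha₁, hρ₁, hdim₁, hA₁⟩,
    ⟨δ₂, hδ₂, a₂, ρ₂, ha₂, hρ₂, hdim₂, hA₂⟩⟩ := exists_factorization_degenerateInCodimTwo hR hR0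
  have hfst : Tendsto (Prod.fst : E × E → E) (𝓝 0) (𝓝 0) := continuous_fst.tendsto' _ _ rfl
  have hsnd : Tendsto (Prod.snd : E × E → E) (𝓝 0) (𝓝 0) := continuous_snd.tendsto' _ _ rfl
  obtain ⟨δ₀, hδ₀, hball₀⟩ := Metric.eventually_nhds_iff_ball.1
    ((hfac.and hG.eventually_analyticAt).and
      ((hfst.eventually hh.eventually_analyticAt).and (hsnd.eventually hk.eventually_analyticAt)))
  obtain ⟨δ, hδ, hδle₀, hδle₁, hδle₂⟩ : ∃ δ > 0, δ ≤ δ₀ ∧ δ ≤ δ₁ ∧ δ ≤ δ₂ :=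
    ⟨min δ₀ (min δ₁ δ₂), lt_min hδ₀ (lt_min hδ₁ hδ₂), min_le_left _ _,
      (min_le_right _ _).trans (min_le_left _ _), (min_le_right _ _).trans (min_le_right _ _)⟩
  have hball : ∀ z ∈ Metric.ball (0 : E) δ, ∀ w ∈ Metric.ball (0 : E) δ,
      ((R (z, w) = h z * k w * G (z, w) ∧ AnalyticAt ℂ G (z, w)) ∧
        AnalyticAt ℂ h z ∧ AnalyticAt ℂ k w) := fun z hz w hw =>
    hball₀ (z, w) (Metric.ball_subset_ball hδle₀ (mem_ball_prod_zero.2 ⟨hz, hw⟩))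
  have h0mem : (0 : E) ∈ Metric.ball (0 : E) δ := Metric.mem_ball_self hδ
  have hstar0 : Tendsto (star : E → E) (𝓝 0) (𝓝 0) := continuous_star.tendsto' _ _ (star_zero E)
  have hne_h : ¬ ∀ᶠ z in 𝓝 0, h z = 0 := fun hev => hR0 (by
    filter_upwards [hfac, hfst.eventually hev] with y h1 h2
    simp [h1, h2])
  let k' : E → ℂ := fun z => star (k (star z))
  have hne_k : ¬ ∀ᶠ z in 𝓝 0, k' z = 0 := fun hev => hR0 (by
    filter_upwards [hfac, hsnd.eventually (hstar0.eventually hev)] with y h1 h2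
    have h3 : k y.2 = 0 := by simpa [k', _root_.star_star] using h2
    simp [h1, h3])
  let G' : E × E → ℂ := fun y => star (G (star y.2, star y.1))
  have hGan : AnalyticOnNhd ℂ G (Metric.ball 0 δ ×ˢ Metric.ball 0 δ) :=
    fun y hy => (hball y.1 hy.1 y.2 hy.2).1.2
  have hGan' : AnalyticOnNhd ℂ G' (Metric.ball 0 δ ×ˢ Metric.ball 0 δ) := fun y hy => by
    have h1 : AnalyticAt ℂ (fun y : E × E => G y.swap) (star y) :=
      (hGan (star y.2, star y.1) ⟨star_mem_ball_zero.2 hy.2, star_mem_ball_zero.2 hy.1⟩).comp_of_eq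
        (analyticAt_snd.prod analyticAt_fst) rfl
    exact h1.star_star
  have hhan : AnalyticOnNhd ℂ h (Metric.ball 0 δ) := fun z hz => (hball z hz 0 h0mem).2.1
  have hkan : AnalyticOnNhd ℂ k' (Metric.ball 0 δ) := fun z hz =>
    (hball 0 h0mem (star z) (star_mem_ball_zero.2 hz)).2.2.star_star
  have hreal : ∀ {g : E → ℂ}, AnalyticOnNhd ℂ g (Metric.ball 0 δ) →
      AnalyticOnNhd ℂ (realifyMul g) (Metric.ball 0 δ ×ˢ Metric.ball 0 δ) := fun hg y hy =>
    analyticAt_realifyMul (hg _ hy.1) (hg _ (star_mem_ball_zero.2 hy.2))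
  have hslice : ∀ {g : E × E → ℂ}, AnalyticOnNhd ℂ g (Metric.ball 0 δ ×ˢ Metric.ball 0 δ) →
      ∀ q ∈ Metric.ball (0 : E) δ, ∀ z ∈ Metric.ball (0 : E) δ,
        AnalyticAt ℂ (fun z => g (z, star q)) z := fun hg q hq z hz =>
    (hg (z, star q) ⟨hz, star_mem_ball_zero.2 hq⟩).comp_of_eq (f := fun z => (z, star q))
      (by fun_prop) rfl
  have hspread : ∀ {g : E → ℂ}, AnalyticOnNhd ℂ g (Metric.ball 0 δ) →
      ∀ q ∈ Metric.ball (0 : E) δ, (∀ᶠ z in 𝓝 q, g z = 0) → ∀ᶠ z in 𝓝 0, g z = 0 :=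
    fun hg q hq hev => Metric.eventually_nhds_iff_ball.2 ⟨δ, hδ, hg.eqOn_zero_ball hq hev⟩
  have hstar_an : ∀ {g : E → ℂ}, AnalyticOnNhd ℂ g (Metric.ball 0 δ₂) →
      AnalyticOnNhd ℂ (fun z => star (g (star z))) (Metric.ball 0 δ) := fun hg z hz =>
    (hg _ (Metric.ball_subset_ball hδle₂ (star_mem_ball_zero.2 hz))).star_star
  have ha₁' := ha₁.mono (Metric.ball_subset_ball hδle₁)
  have hρ₁' := hρ₁.mono (Metric.ball_subset_ball hδle₁)
  refine ⟨δ, hδ, fun y => G y * G' y * (realifyMul h y * realifyMul k' y),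
    ![fun z => a₁ z * star (a₂ (star z)), fun z => a₁ z * star (ρ₂ (star z)),
      fun z => ρ₁ z * star (a₂ (star z)), fun z => ρ₁ z * star (ρ₂ (star z))],
    (hGan.mul hGan').mul ((hreal hhan).mul (hreal hkan)), ?_, fun z hz => ⟨?_, ?_⟩, ?_,
    fun q hq hev => ?_⟩
  · intro i
    fin_cases i
    · exact ha₁'.mul (hstar_an ha₂)
    · exact ha₁'.mul (hstar_an hρ₂)
    · exact hρ₁'.mul (hstar_an ha₂)
    · exact hρ₁'.mul (hstar_an hρ₂)
  · simp only [G', _root_.star_star, RCLike.star_def, Complex.mul_conj, realifyMul_star]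
    rw [← Complex.ofReal_mul, ← Complex.ofReal_mul, Complex.ofReal_im]
  · rw [(hball z hz (star z) (star_mem_ball_zero.2 hz)).1.1]
    simp only [mul_eq_zero, realifyMul_star_eq_zero, G', k', _root_.star_star, star_eq_zero]
    tauto
  · have h1 : dimH {x ∈ Metric.ball (0 : E) δ | a₁ x = 0 ∧ ρ₁ x = 0} ≤
        ((2 * Module.finrank ℂ E - 4 : ℕ) : ℝ≥0∞) := by
      refine (dimH_mono ?_).trans hdim₁
      exact fun x hx => ⟨Metric.ball_subset_ball hδle₁ hx.1, hx.2⟩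
    have h2 : dimH {x ∈ Metric.ball (0 : E) δ | a₂ (star x) = 0 ∧ ρ₂ (star x) = 0} ≤
        ((2 * Module.finrank ℂ E - 4 : ℕ) : ℝ≥0∞) := by
      rw [← (star_isometry (E := E)).dimH_image]
      refine (dimH_mono ?_).trans hdim₂
      rintro - ⟨x, ⟨hx, hx2⟩, rfl⟩
      exact ⟨Metric.ball_subset_ball hδle₂ (star_mem_ball_zero.2 hx), hx2⟩
    refine (dimH_mono ?_).trans ((dimH_union _ _).trans_le (max_le h1 h2))
    rintro x ⟨hx, hf⟩
    have f0 := hf 0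
    have f1 := hf 1
    have f2 := hf 2
    have f3 := hf 3
    simp only [Matrix.cons_val, mul_eq_zero, star_eq_zero] at f0 f1 f2 f3
    simp only [mem_union, mem_ofPred_eq]
    tauto
  · have hor : (a₁ q = 0 ∧ ρ₁ q = 0) ∨ (a₂ (star q) = 0 ∧ ρ₂ (star q) = 0) := by
      rcases ((hslice hGan q hq q hq).mul (hslice hGan' q hq q hq)).eventually_zero_or
        ((hslice (hreal hhan) q hq q hq).mul (hslice (hreal hkan) q hq q hq)) hev with hev | hev
      · rcases (hslice hGan q hq q hq).eventually_zero_or (hslice hGan' q hq q hq) hev with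
          hev | hev
        · exact Or.inr (hA₂ (star q) (Metric.ball_subset_ball hδle₂ (star_mem_ball_zero.2 hq))
            (hspread (hslice hGan q hq) q hq hev))
        · refine Or.inl (hA₁ q (Metric.ball_subset_ball hδle₁ hq) ?_)
          have h1 := hstar0.eventually (hspread (hslice hGan' q hq) q hq hev)
          simpa [G', _root_.star_star] using h1
      · rcases (hslice (hreal hhan) q hq q hq).eventually_zero_or
          (hslice (hreal hkan) q hq q hq) hev with hev | hev
        · exact absurd (hspread hhan q hq (eventually_eq_zero_of_realifyMul hev)) hne_h
        · exact absurd (hspread hkan q hq (eventually_eq_zero_of_realifyMul hev)) hne_k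
    intro i
    rcases hor with ⟨h1, h2⟩ | ⟨h1, h2⟩ <;> fin_cases i <;> simp [h1, h2]

end RealDefiningFunction

section SegreDegenerate

variable {N : ℕ}

theorem conjPt_eq_star (z : CN N) : conjPt N z = star z := rfl

theorem IsRealSubvariety.exists_defining_function {U H : Set (CN N)} (hH : IsRealSubvariety N U H)
    {p : CN N} (hp : p ∈ U) : ∃ (V : Set (CN N)) (r : CN N → ℝ), IsOpen V ∧ p ∈ V ∧
      AnalyticAt ℝ r p ∧ H ∩ V = {z ∈ V | r z = 0} := by
  obtain ⟨V, hV, hpV, -, k, f, hf, hHV⟩ := hH.2.2 p hp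
  refine ⟨V, fun z => ∑ i, f i z ^ 2, hV, hpV, Finset.analyticAt_fun_sum _ fun i _ =>
    ((hV.analyticOn_iff_analyticOnNhd.1 (hf i)) p hpV).pow 2, ?_⟩
  rw [hHV]
  ext z
  refine and_congr_right fun _ => ?_
  rw [Finset.sum_eq_zero_iff_of_nonneg fun i _ => sq_nonneg _]
  simp

theorem isComplexSubvariety_of_analyticOnNhd {V : Set (CN N)} (hV : IsOpen V) {k : ℕ}
    {f : Fin k → CN N → ℂ} (hf : ∀ i, AnalyticOnNhd ℂ (f i) V) :
    IsComplexSubvariety N V {z ∈ V | ∀ i, f i z = 0} := by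
  refine ⟨fun z hz => hz.1, fun z hz => ⟨hz.2, fun i => ?_⟩, fun p hp =>
    ⟨V, hV, hp, subset_rfl, k, f, fun i => (hf i).analyticOn, ?_⟩⟩
  · refine closure_minimal (s := f i '' {z ∈ V | ∀ i, f i z = 0}) (t := {0}) ?_
      isClosed_singleton ((hf i z hz.2).continuousAt.continuousWithinAt.mem_closure_image hz.1)
    rintro - ⟨z, hz, rfl⟩
    exact hz.2 i
  · exact inter_eq_left.2 fun z hz => hz.1

theorem interior_eq_empty_of_dimH_lt {H : Set (CN N)} (hH : dimH H < ((2 * N : ℕ) : ℝ≥0∞)) :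
    interior H = ∅ := by
  by_contra hne
  refine hH.ne ?_
  rw [Real.dimH_of_nonempty_interior (nonempty_iff_ne_empty.2 hne),
    ← Real.dimH_univ_eq_finrank, dimH_univ_fin_complex]

end SegreDegenerate

/-- the set of Segre-degenerate singularities of a Levi-flat
real-hypervariety is contained (locally) in a complex subvariety of complex dimension
`N - 2` or less. -/
theorem stmt5 (N : ℕ) (U H : Set (CN N)) (hH : IsLeviFlatHypervariety N U H)
    (p : CN N) (hp : p ∈ H) (hdeg : IsSegreDegenerateAt N H p) :
    ∃ V A : Set (CN N), IsOpen V ∧ p ∈ V ∧ IsComplexSubvariety N V A ∧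
      dimH A ≤ ((2 * N - 4 : ℕ) : ℝ≥0∞) ∧
      {q ∈ H | IsSegreDegenerateAt N H q} ∩ V ⊆ A := by
  obtain ⟨-, hreal, hdim, -⟩ := hH
  rcases Nat.eq_zero_or_pos N with rfl | hN
  · refine ⟨univ, univ, isOpen_univ, mem_univ _, ?_, ?_, subset_univ _⟩
    · simpa using isComplexSubvariety_of_analyticOnNhd (N := 0) isOpen_univ
        (f := fun (i : Fin 0) _ => 0) fun _ => analyticOnNhd_const
    · rw [dimH_subsingleton (subsingleton_of_subsingleton)]
      exact bot_le
  have hint : interior H = ∅ := interior_eq_empty_of_dimH_lt (by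
    rw [hdim]
    exact_mod_cast (by omega : 2 * N - 1 < 2 * N))
  obtain ⟨V₀, r, hV₀, hpV₀, hr, hHr⟩ := hreal.exists_defining_function (hreal.1 hp)
  obtain ⟨R, hR, hRr⟩ := hr.exists_polarization
  have hdiag : Tendsto (fun z : CN N => (z, star z)) (𝓝 0) (𝓝 0) :=
    Continuous.tendsto' (by fun_prop) _ _ (by simp)
  have hadd : Tendsto (fun z : CN N => p + z) (𝓝 0) (𝓝 p) :=
    Continuous.tendsto' (by fun_prop) _ _ (by simp)
  have hsub : Tendsto (fun z : CN N => z - p) (𝓝 p) (𝓝 0) :=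
    Continuous.tendsto' (by fun_prop) _ _ (by simp)
  have hR0 : ¬ ∀ᶠ y in 𝓝 0, R y = 0 := fun hev => by
    have h1 : ∀ᶠ z in 𝓝 p, z ∈ H := by
      filter_upwards [hsub.eventually (hdiag.eventually hev), hsub.eventually hRr,
        hV₀.mem_nhds hpV₀] with z h1 h2 h3
      rw [h1, add_sub_cancel, eq_comm, Complex.ofReal_eq_zero] at h2
      exact (hHr.ge ⟨h3, h2⟩).1
    exact (eq_empty_iff_forall_notMem.1 hint p) (mem_interior_iff_mem_nhds.2 h1)
  obtain ⟨δ₀, hδ₀, S, f, hS, hf, hdiagS, hdimA, hdegS⟩ := exists_realification hR hR0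
  obtain ⟨δ₁, hδ₁, hball₁⟩ := Metric.eventually_nhds_iff_ball.1
    (hRr.and (hadd.eventually (hV₀.mem_nhds hpV₀)))
  let δ := min δ₀ δ₁
  have hsubball : ∀ {z}, z ∈ Metric.ball p δ → z - p ∈ Metric.ball (0 : CN N) δ := fun hz => by
    simpa [dist_eq_norm] using hz
  have hsubball₀ : ∀ {z}, z ∈ Metric.ball p δ → z - p ∈ Metric.ball (0 : CN N) δ₀ := fun hz =>
    Metric.ball_subset_ball (min_le_left _ _) (hsubball hz)
  have hS_at : ∀ z ∈ Metric.ball p δ, ∀ w ∈ Metric.ball p δ,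
      AnalyticAt ℂ S (z - p, star w - star p) := fun z hz w hw =>
    hS _ ⟨hsubball₀ hz, by
      rw [← star_sub]
      exact star_mem_ball_zero.2 (hsubball₀ hw)⟩
  refine ⟨Metric.ball p δ, {z ∈ Metric.ball p δ | ∀ i, f i (z - p) = 0}, Metric.isOpen_ball,
    Metric.mem_ball_self (lt_min hδ₀ hδ₁),
    isComplexSubvariety_of_analyticOnNhd (f := fun i z => f i (z - p)) Metric.isOpen_ball
      fun i z hz => (hf i _ (hsubball₀ hz)).comp_of_eq (analyticAt_id.sub analyticAt_const) rfl,
    ?_, ?_⟩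
  · rw [Module.finrank_fin_fun] at hdimA
    rw [← (IsometryEquiv.subRight p).isometry.dimH_image]
    refine (dimH_mono ?_).trans hdimA
    rintro - ⟨z, ⟨hz, hz0⟩, rfl⟩
    exact ⟨hsubball₀ hz, hz0⟩
  rintro q ⟨⟨hqH, hq⟩, hqV⟩
  refine ⟨hqV, hdegS (q - p) (hsubball₀ hqV) ?_⟩
  have key := hq (Metric.ball p δ) (fun z => (S (z - p, star z - star p)).re)
    (fun z w => S (z - p, w - star p)) Metric.isOpen_ball hqV (fun z hz => ?_) ⟨?_, fun z hz => ?_⟩ ?_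
  · have hq' : Tendsto (fun z => z + p) (𝓝 (q - p)) (𝓝 q) :=
      Continuous.tendsto' (by fun_prop) _ _ (by simp)
    filter_upwards [hq'.eventually key] with z hz
    rwa [add_sub_cancel_right, conjPt_eq_star, ← star_sub] at hz
  · have h1 : AnalyticAt ℝ (fun z : CN N => (z - p, star z - star p)) z :=
      (analyticAt_id.sub analyticAt_const).prod
        (((starL' ℝ : CN N ≃L[ℝ] CN N).toContinuousLinearMap.analyticAt z).sub analyticAt_const)
    exact ((Complex.reCLM.analyticAt _).comp
      ((hS_at z hz z hz).restrictScalars.comp_of_eq h1 rfl)).analyticWithinAt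
  · rintro ⟨z, -⟩ ⟨hz, w, hw, rfl⟩
    exact ((hS_at z hz w hw).comp_of_eq (f := fun y : CN N × CN N => (y.1 - p, y.2 - star p))
      ((analyticAt_fst.sub analyticAt_const).prod (analyticAt_snd.sub analyticAt_const))
      rfl).analyticWithinAt
  · have h := (hdiagS _ (hsubball₀ hz)).1
    rw [star_sub] at h
    exact Complex.ext (by simp [conjPt_eq_star]) (by simpa [conjPt_eq_star] using h)
  · ext z
    rw [mem_inter_iff, and_comm]
    refine and_congr_right fun hz => ?_
    obtain ⟨h1, h2⟩ := hball₁ (z - p) (Metric.ball_subset_ball (min_le_right _ _) (hsubball hz))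
    obtain ⟨h3, h4⟩ := hdiagS _ (hsubball₀ hz)
    rw [add_sub_cancel] at h1 h2
    have h5 : z ∈ H ↔ r z = 0 :=
      ⟨fun h => (hHr.le ⟨h, h2⟩).2, fun h => (hHr.ge ⟨h2, h⟩).1⟩
    rw [h5, ← Complex.ofReal_eq_zero, ← h1, ← h4, Complex.ext_iff]
    rw [star_sub] at h3 ⊢
    simp [h3]
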